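/- arXiv:1803.06712 — 6 statements merged into one kernel-verified Lean document; each statement's English description precedes it below -/
import Mathlib

section
/- For every atomless (continuous) σ-additive Borel probability measure μ on a Polish space X and every real number a with 0 < a < 1, there exists an injective continuous map f : 2^ω → X such that μ(f(B)) = a · λ(B) for every Borel subset B of the Cantor cube 2^ω. -/
open MeasureTheory

/-- The Haar (fair-coin product) probability measure `λ` on the Cantor cube
`2^ω = ℕ → ZMod 2`. -/
noncomputable def cantorHaar : Measure (ℕ → ZMod 2) :=
  Measure.addHaarMeasure ⊤

open Set Topology

theorem exists_isCompact_subset_measureReal_mem_Ioc {X : Type*} [TopologicalSpace X]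
    [PolishSpace X] [MeasurableSpace X] [BorelSpace X] (μ : Measure X) [IsFiniteMeasure μ]
    (hμ : ∀ x, μ {x} = 0) {E : Set X} (hE : MeasurableSet E) {b c : ℝ} (hb : 0 ≤ b)
    (hbE : b < μ.real E) (hbc : b < c) :
    ∃ C ⊆ E, IsCompact C ∧ μ.real C ∈ Ioc b c := by
  classical
  have compact_lt : ∀ F : Set X, MeasurableSet F → b < μ.real F →
      ∃ C ⊆ F, IsCompact C ∧ b < μ.real C := by
    intro F hF hbF
    obtain ⟨C, hCF, hC, h⟩ := hF.exists_lt_isCompact_of_ne_top (measure_ne_top μ F)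
      (r := ENNReal.ofReal b)
      ((ENNReal.ofReal_lt_iff_lt_toReal hb (measure_ne_top μ F)).2 hbF)
    exact ⟨C, hCF, hC, (ENNReal.ofReal_lt_iff_lt_toReal hb (measure_ne_top μ C)).1 h⟩
  obtain ⟨E', hE'E, hE', hbE'⟩ := compact_lt E hE hbE
  have small_nhds : ∀ x : X, ∃ U, x ∈ U ∧ IsOpen U ∧ μ.real U < c - b := by
    intro x
    obtain ⟨U, hxU, hU, h⟩ := Set.exists_isOpen_lt_of_lt {x} (ENNReal.ofReal (c - b))
      (by rw [hμ x]; exact ENNReal.ofReal_pos.2 (sub_pos.2 hbc))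
    exact ⟨U, hxU rfl, hU, (ENNReal.lt_ofReal_iff_toReal_lt (measure_ne_top μ U)).1 h⟩
  choose U hxU hU hUlt using small_nhds
  obtain ⟨T, -, hT⟩ := hE'.elim_nhds_subcover U fun x _ ↦ (hU x).mem_nhds (hxU x)
  have grow : ∀ T : Finset X, b < μ.real (E' ∩ ⋃ x ∈ T, U x) →
      ∃ F ⊆ E', MeasurableSet F ∧ μ.real F ∈ Ioc b c := by
    intro T
    induction T using Finset.induction_on with
    | empty => intro h; simp at h; linarith
    | insert x T _ ih =>
      intro h
      by_cases hT : b < μ.real (E' ∩ ⋃ x ∈ T, U x)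
      · exact ih hT
      · refine ⟨_, inter_subset_left, hE'.measurableSet.inter
          ((insert x T).measurableSet_biUnion fun y _ ↦ (hU y).measurableSet), h, ?_⟩
        have : E' ∩ ⋃ y ∈ insert x T, U y ⊆ U x ∪ (E' ∩ ⋃ y ∈ T, U y) := by
          rw [Finset.set_biUnion_insert, inter_union_distrib_left]
          exact union_subset_union_left _ inter_subset_right
        have h1 := measureReal_mono (μ := μ) this
        have h2 := measureReal_union_le (μ := μ) (U x) (E' ∩ ⋃ y ∈ T, U y)
        have h3 := hUlt x
        linarith
  obtain ⟨F, hFE, hF, hbF, hFc⟩ := grow T (by rwa [inter_eq_left.2 hT])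
  obtain ⟨C, hCF, hC, hbC⟩ := compact_lt F hF hbF
  exact ⟨C, hCF.trans (hFE.trans hE'E), hC, hbC, (measureReal_mono hCF).trans hFc⟩

theorem IsCompact.exists_equipartition_small_diam {X : Type*} [MetricSpace X]
    [PolishSpace X] [MeasurableSpace X] [BorelSpace X] (μ : Measure X) [IsFiniteMeasure μ]
    (hμ : ∀ x, μ {x} = 0) {K : Set X} (hK : IsCompact K) {b c ε : ℝ} (hb : 0 ≤ b)
    (hbK : b < μ.real K) (hbc : b < c) (hε : 0 < ε) :
    ∃ N₀ : ℕ, ∀ N ≥ N₀, ∃ L : ℕ → Set X, (∀ i < N, L i ⊆ K ∧ IsCompact (L i) ∧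
      (∀ p ∈ L i, ∀ q ∈ L i, dist p q ≤ ε) ∧ μ.real (L i) ∈ Ioc (b / N) (c / N)) ∧
      ∀ i < N, ∀ j < i, Disjoint (L i) (L j) := by
  obtain ⟨d, hbd, hd⟩ := exists_between (lt_min hbK hbc)
  obtain ⟨hdK, hdc⟩ := lt_min_iff.1 hd
  obtain ⟨T, -, hT⟩ := hK.elim_nhds_subcover (fun x ↦ Metric.ball x (ε / 2))
    fun x _ ↦ Metric.ball_mem_nhds x (half_pos hε)
  obtain ⟨N₀, hN₀⟩ := exists_nat_ge (T.card * b / (μ.real K - d))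
  refine ⟨N₀ + 1, fun N hN ↦ ?_⟩
  have hNpos : (0 : ℝ) < N := by exact_mod_cast (by omega : 0 < N)
  have hTb : T.card * (b / N) ≤ μ.real K - d := by
    have h1 : (N₀ : ℝ) ≤ N := by exact_mod_cast (by omega : N₀ ≤ N)
    have h2 := hN₀.trans h1
    rw [div_le_iff₀ (by linarith)] at h2
    rw [← mul_div_assoc, div_le_iff₀ hNpos]
    linarith
  have greedy : ∀ n ≤ N, ∃ L : ℕ → Set X, (∀ i < n, L i ⊆ K ∧ IsCompact (L i) ∧
      (∀ p ∈ L i, ∀ q ∈ L i, dist p q ≤ ε) ∧ μ.real (L i) ∈ Ioc (b / N) (d / N)) ∧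
      ∀ i < n, ∀ j < i, Disjoint (L i) (L j) := by
    intro n
    induction n with
    | zero => intro _; exact ⟨fun _ ↦ ∅, by simp, by simp⟩
    | succ n ih =>
      intro hn
      obtain ⟨L, hL, hdisj⟩ := ih (by omega)
      set P := ⋃ i ∈ Finset.range n, L i
      have hPm : MeasurableSet P := (Finset.range n).measurableSet_biUnion
        fun i hi ↦ (hL i (Finset.mem_range.1 hi)).2.1.measurableSet
      have hPle : μ.real P ≤ n * (d / N) := by
        refine (measureReal_biUnion_finset_le _ _).trans
          ((Finset.sum_le_card_nsmul _ _ (d / N) fun i hi ↦ ?_).trans (by simp))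
        exact (hL i (Finset.mem_range.1 hi)).2.2.2.2
      have hnd : n * (d / N) < d := by
        rw [← mul_div_assoc, div_lt_iff₀ hNpos, mul_comm]
        have : (n : ℝ) < N := by exact_mod_cast hn
        exact mul_lt_mul_of_pos_left this (by linarith)
      have hKP : μ.real K ≤ μ.real P + μ.real (K \ P) := by
        refine (measureReal_mono ?_).trans (measureReal_union_le _ _)
        rw [union_sdiff_self]; exact subset_union_right
      obtain ⟨x, -, hx⟩ : ∃ x ∈ T, b / N < μ.real (Metric.ball x (ε / 2) ∩ (K \ P)) := by
        by_contra! h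
        have h1 : μ.real (K \ P) ≤ μ.real (⋃ x ∈ T, Metric.ball x (ε / 2) ∩ (K \ P)) := by
          refine measureReal_mono ?_ (MeasureTheory.measure_ne_top μ _)
          rw [← iUnion₂_inter]
          exact fun y hy ↦ ⟨hT hy.1, hy⟩
        have h2 := (h1.trans (measureReal_biUnion_finset_le _ _)).trans
          (Finset.sum_le_card_nsmul _ _ (b / N) h)
        rw [nsmul_eq_mul] at h2
        linarith
      obtain ⟨C, hC, hCc, hCm⟩ := exists_isCompact_subset_measureReal_mem_Ioc μ hμ
        (measurableSet_ball.inter (hK.measurableSet.diff hPm)) (by positivity) hx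
        ((div_lt_div_iff_of_pos_right hNpos).2 hbd)
      have hne : ∀ i < n, Function.update L n C i = L i := fun i hi ↦
        Function.update_of_ne hi.ne _ _
      refine ⟨Function.update L n C, fun i hi ↦ ?_, fun i hi j hj ↦ ?_⟩
      · rcases Nat.lt_succ_iff_lt_or_eq.1 hi with hi | rfl
        · rw [hne i hi]; exact hL i hi
        · rw [Function.update_self]
          refine ⟨fun y hy ↦ (hC hy).2.1, hCc, fun p hp q hq ↦ ?_, hCm⟩
          have h1 := Metric.mem_ball.1 (hC hp).1
          have h2 := Metric.mem_ball.1 (hC hq).1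
          have h3 := dist_triangle_right p q x
          linarith
      · rcases Nat.lt_succ_iff_lt_or_eq.1 hi with hi | rfl
        · rw [hne i hi, hne j (hj.trans hi)]; exact hdisj i hi j hj
        · rw [Function.update_self, hne j hj]
          refine disjoint_left.2 fun y hy hyj ↦ (hC hy).2.2 ?_
          exact mem_biUnion (Finset.mem_coe.2 (Finset.mem_range.2 hj)) hyj
  obtain ⟨L, hL, hdisj⟩ := greedy N le_rfl
  refine ⟨L, fun i hi ↦ ?_, hdisj⟩
  obtain ⟨h1, h2, h3, h4, h5⟩ := hL i hi
  exact ⟨h1, h2, h3, h4, h5.trans (by gcongr)⟩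

/-- Pairwise disjoint compact sets of measure greater than `a / 2 ^ length`, indexed by the binary
words of a given length. -/
structure CompactLevel {X : Type*} [TopologicalSpace X] [MeasurableSpace X]
    (μ : Measure X) (a : ℝ) where
  length : ℕ
  piece : (Fin length → ZMod 2) → Set X
  isCompact_piece : ∀ s, IsCompact (piece s)
  disjoint_piece : Pairwise (Function.onFun Disjoint piece)
  lt_measureReal_piece : ∀ s, a / 2 ^ length < μ.real (piece s)

/-- The initial word of length `n` of a point of the Cantor cube. -/
def initialWord (n : ℕ) (x : ℕ → ZMod 2) : Fin n → ZMod 2 := fun i ↦ x i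

theorem CompactLevel.exists_refinement {X : Type*} [MetricSpace X]
    [PolishSpace X] [MeasurableSpace X] [BorelSpace X] {μ : Measure X} [IsFiniteMeasure μ]
    (hμ : ∀ x, μ {x} = 0) {a ε : ℝ} (ha : 0 < a) (hε : 0 < ε) (S : CompactLevel μ a) :
    ∃ S' : CompactLevel μ a, S.length < S'.length ∧
      (∀ x, S'.piece (initialWord _ x) ⊆ S.piece (initialWord _ x)) ∧
      ∀ s, (∀ p ∈ S'.piece s, ∀ q ∈ S'.piece s, dist p q ≤ ε) ∧
        μ.real (S'.piece s) ≤ (a + ε) / 2 ^ S'.length := by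
  have part s := (S.isCompact_piece s).exists_equipartition_small_diam μ hμ (b := a / 2 ^ S.length)
    (c := (a + ε) / 2 ^ S.length) (by positivity) (S.lt_measureReal_piece s)
    (by gcongr; linarith) hε
  choose N₀ hN₀ using part
  set m := Finset.univ.sup N₀ + 1 with hm
  have hm' : ∀ s, 2 ^ m ≥ N₀ s := fun s ↦ by
    have := Finset.le_sup (f := N₀) (Finset.mem_univ s)
    have := Nat.lt_two_pow_self (n := m)
    omega
  choose L hL hdisj using fun s ↦ hN₀ s (2 ^ m) (hm' s)
  have e : (Fin m → ZMod 2) ≃ Fin (2 ^ m) := Fintype.equivFinOfCardEq (by simp [ZMod.card])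
  refine ⟨⟨S.length + m, fun t ↦ L (fun i ↦ t (Fin.castAdd m i)) (e fun i ↦ t (Fin.natAdd _ i)),
    fun t ↦ (hL _ _ (e _).2).2.1, fun s t hst ↦ ?_, fun t ↦ ?_⟩, ?_, fun x ↦ ?_, fun t ↦
    ⟨(hL _ _ (e _).2).2.2.1, ?_⟩⟩
  · by_cases h : (fun i ↦ s (Fin.castAdd m i)) = fun i ↦ t (Fin.castAdd m i)
    · have h' : e (fun i ↦ s (Fin.natAdd _ i)) ≠ e (fun i ↦ t (Fin.natAdd _ i)) := by
        refine e.injective.ne fun h' ↦ hst (funext fun i ↦ ?_)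
        refine Fin.addCases (fun i ↦ congrFun h i) (fun i ↦ congrFun h' i) i
      simp only [Function.onFun, h]
      rcases lt_or_gt_of_ne h' with h' | h'
      · exact (hdisj _ _ (e _).2 _ h').symm
      · exact hdisj _ _ (e _).2 _ h'
    · exact (S.disjoint_piece h).mono (hL _ _ (e _).2).1 (hL _ _ (e _).2).1
  · have := (hL (fun i ↦ t (Fin.castAdd m i)) _ (e fun i ↦ t (Fin.natAdd _ i)).2).2.2.2.1
    rwa [Nat.cast_pow, Nat.cast_ofNat, div_div, ← pow_add] at this
  · simp only; omega
  · exact (hL _ _ (e _).2).1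
  · have := (hL (fun i ↦ t (Fin.castAdd m i)) _ (e fun i ↦ t (Fin.natAdd _ i)).2).2.2.2.2
    rwa [Nat.cast_pow, Nat.cast_ofNat, div_div, ← pow_add] at this

instance : IsProbabilityMeasure cantorHaar :=
  ⟨Measure.addHaarMeasure_self (G := ℕ → ZMod 2) (K₀ := ⊤)⟩

instance : cantorHaar.IsAddLeftInvariant := by unfold cantorHaar; infer_instance

theorem initialWord_surjective (n : ℕ) : Function.Surjective (initialWord n) := fun s ↦
  ⟨fun i ↦ if h : i < n then s ⟨i, h⟩ else 0, by funext i; simp [initialWord]⟩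

theorem measurable_initialWord (n : ℕ) : Measurable (initialWord n) :=
  measurable_pi_lambda _ fun i ↦ measurable_pi_apply (i : ℕ)

theorem continuous_initialWord (n : ℕ) : Continuous (initialWord n) :=
  continuous_pi fun i ↦ continuous_apply (i : ℕ)

theorem cantorHaar_preimage_initialWord_singleton (n : ℕ) (s : Fin n → ZMod 2) :
    cantorHaar.real (initialWord n ⁻¹' {s}) = 1 / 2 ^ n := by
  have translate : ∀ t, cantorHaar.real (initialWord n ⁻¹' {t}) =
      cantorHaar.real (initialWord n ⁻¹' {s}) := by
    intro t
    let z : ℕ → ZMod 2 := fun i ↦ if h : i < n then t ⟨i, h⟩ - s ⟨i, h⟩ else 0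
    have hz : (fun x ↦ z + x) ⁻¹' (initialWord n ⁻¹' {t}) = initialWord n ⁻¹' {s} := by
      ext x
      simp only [mem_preimage, mem_singleton_iff, funext_iff, initialWord]
      refine forall_congr' fun i ↦ ?_
      simp only [z, Pi.add_apply, Fin.is_lt, dite_true, Fin.eta]
      constructor <;> intro h
      · linear_combination h
      · linear_combination h
    rw [← hz, measureReal_def, measureReal_def, measure_preimage_add]
  have total : ∑ t, cantorHaar.real (initialWord n ⁻¹' {t}) = 1 := by
    rw [← measureReal_iUnion_fintype]
    · rw [← preimage_iUnion, iUnion_of_singleton, preimage_univ, probReal_univ]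
    · exact fun u v huv ↦ Disjoint.preimage _ (disjoint_singleton.2 huv)
    · exact fun t ↦ measurable_initialWord n (measurableSet_singleton t)
  simp only [translate] at total
  rw [Finset.sum_const, Finset.card_univ, Fintype.card_fun, ZMod.card, Fintype.card_fin,
    nsmul_eq_mul] at total
  push_cast at total
  field_simp
  linarith

/-- The sets determined by finitely many coordinates of the Cantor cube. -/
def cantorClopens : Set (Set (ℕ → ZMod 2)) :=
  {E | ∃ n, ∃ A : Set (Fin n → ZMod 2), initialWord n ⁻¹' A = E}

theorem preimage_initialWord_mono {n m : ℕ} (h : n ≤ m) (A : Set (Fin n → ZMod 2)) :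
    initialWord n ⁻¹' A = initialWord m ⁻¹' {s | (fun i ↦ s (Fin.castLE h i)) ∈ A} := rfl

theorem isPiSystem_cantorClopens : IsPiSystem cantorClopens := by
  rintro _ ⟨n, A, rfl⟩ _ ⟨m, B, rfl⟩ -
  rw [preimage_initialWord_mono (le_max_left n m), preimage_initialWord_mono (le_max_right n m)]
  exact ⟨_, _, preimage_inter⟩

theorem generateFrom_cantorClopens :
    (inferInstance : MeasurableSpace (ℕ → ZMod 2)) =
      MeasurableSpace.generateFrom cantorClopens := by
  apply le_antisymm
  · refine iSup_le fun i ↦ ?_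
    rintro _ ⟨A, -, rfl⟩
    exact MeasurableSpace.measurableSet_generateFrom
      ⟨i + 1, {s | s (Fin.last i) ∈ A}, rfl⟩
  · refine MeasurableSpace.generateFrom_le ?_
    rintro _ ⟨n, A, rfl⟩
    exact measurable_initialWord n A.toFinite.measurableSet

/-- A finite measure on the Cantor cube of total mass at least `a`, whose values at cylinders of
arbitrarily large length are asymptotically at most those of `a • cantorHaar`, is equal to it. -/
theorem eq_smul_cantorHaar {ν : Measure (ℕ → ZMod 2)} [IsFiniteMeasure ν] {a : ℝ} (ha : 0 ≤ a)
    (huniv : a ≤ ν.real univ)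
    (h : ∀ ε > 0, ∀ m : ℕ, ∃ n ≥ m, ∀ s, ν.real (initialWord n ⁻¹' {s}) ≤ (a + ε) / 2 ^ n) :
    ν = ENNReal.ofReal a • cantorHaar := by
  have upper : ∀ E ∈ cantorClopens, ν.real E ≤ a * cantorHaar.real E := by
    rintro _ ⟨m, A, rfl⟩
    refine le_of_forall_pos_le_add fun ε hε ↦ ?_
    obtain ⟨n, hn, hs⟩ := h ε hε m
    rw [preimage_initialWord_mono hn]
    set B := {s : Fin n → ZMod 2 | (fun i ↦ s (Fin.castLE hn i)) ∈ A}
    have sum_eq : ∀ (ρ : Measure (ℕ → ZMod 2)) [IsFiniteMeasure ρ],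
        ρ.real (initialWord n ⁻¹' B) =
          ∑ s ∈ B.toFinite.toFinset, ρ.real (initialWord n ⁻¹' {s}) := by
      intro ρ _
      rw [← measureReal_biUnion_finset]
      · congr 1; ext x; simp
      · exact fun u _ v _ huv ↦ Disjoint.preimage _ (disjoint_singleton.2 huv)
      · exact fun t _ ↦ measurable_initialWord n (measurableSet_singleton t)
    have h1 : ν.real (initialWord n ⁻¹' B) ≤ (a + ε) * cantorHaar.real (initialWord n ⁻¹' B) := by
      rw [sum_eq, sum_eq, Finset.mul_sum]
      refine Finset.sum_le_sum fun s _ ↦ (hs s).trans_eq ?_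
      rw [cantorHaar_preimage_initialWord_singleton]; ring
    have h2 : cantorHaar.real (initialWord n ⁻¹' B) ≤ 1 := measureReal_le_one
    nlinarith
  have heq : ∀ E ∈ cantorClopens, ν.real E = a * cantorHaar.real E := by
    intro E hE
    have hEm : MeasurableSet E := by
      obtain ⟨n, A, rfl⟩ := hE
      exact measurable_initialWord n A.toFinite.measurableSet
    have hEc : Eᶜ ∈ cantorClopens := by
      obtain ⟨n, A, rfl⟩ := hE
      exact ⟨n, Aᶜ, rfl⟩
    have h1 := upper E hE
    have h2 := upper Eᶜ hEc
    have h3 := measureReal_add_measureReal_compl (μ := ν) hEm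
    have h4 := measureReal_add_measureReal_compl (μ := cantorHaar) hEm
    rw [probReal_univ] at h4
    nlinarith
  have heq' : ∀ E ∈ cantorClopens, ν E = (ENNReal.ofReal a • cantorHaar) E := by
    intro E hE
    have := congrArg ENNReal.ofReal (heq E hE)
    rwa [ENNReal.ofReal_mul ha, ofReal_measureReal, ofReal_measureReal] at this
  exact ext_of_generate_finite _ generateFrom_cantorClopens isPiSystem_cantorClopens heq'
    (heq' univ ⟨0, univ, rfl⟩)

/-- A sequence of refining levels whose pieces have vanishing diameters and asymptotically optimal
measures. -/
theorem CompactLevel.exists_sequence {X : Type*} [MetricSpace X]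
    [PolishSpace X] [MeasurableSpace X] [BorelSpace X] {μ : Measure X} [IsFiniteMeasure μ]
    (hμ : ∀ x, μ {x} = 0) {a : ℝ} (ha : 0 < a) (haμ : a < μ.real univ) :
    ∃ T : ℕ → CompactLevel μ a, StrictMono (fun k ↦ (T k).length) ∧
      (∀ k x, (T (k + 1)).piece (initialWord _ x) ⊆ (T k).piece (initialWord _ x)) ∧
      ∀ ε > 0, ∃ k₀, ∀ k ≥ k₀, ∀ s,
        (∀ p ∈ (T k).piece s, ∀ q ∈ (T k).piece s, dist p q ≤ ε) ∧
          μ.real ((T k).piece s) ≤ (a + ε) / 2 ^ (T k).length := by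
  obtain ⟨C, -, hC, hCm⟩ := exists_isCompact_subset_measureReal_mem_Ioc μ hμ MeasurableSet.univ
    ha.le haμ (lt_add_one a)
  let S₀ : CompactLevel μ a := ⟨0, fun _ ↦ C, fun _ ↦ hC,
    fun s t hst ↦ (hst (Subsingleton.elim s t)).elim, fun _ ↦ by simpa using hCm.1⟩
  choose next hlen hsub hsmall using
    fun (k : ℕ) (S : CompactLevel μ a) ↦
      S.exists_refinement hμ (ε := 1 / ((k : ℝ) + 1)) ha (by positivity)
  let T : ℕ → CompactLevel μ a := fun k ↦ Nat.rec S₀ next k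
  refine ⟨T, strictMono_nat_of_lt_succ fun k ↦ hlen k (T k), fun k ↦ hsub k (T k),
    fun ε hε ↦ ?_⟩
  obtain ⟨k₀, hk₀⟩ := exists_nat_one_div_lt hε
  refine ⟨k₀ + 1, fun k hk s ↦ ?_⟩
  obtain ⟨j, rfl⟩ := Nat.exists_eq_add_of_le' (Nat.one_le_of_lt hk)
  have hj : 1 / ((j : ℝ) + 1) ≤ ε := by
    refine le_trans ?_ hk₀.le
    have : (k₀ : ℝ) ≤ j := by exact_mod_cast (by omega : k₀ ≤ j)
    gcongr
  obtain ⟨h1, h2⟩ := hsmall j (T j) s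
  exact ⟨fun p hp q hq ↦ (h1 p hp q hq).trans hj, h2.trans (by gcongr)⟩

/-- For every atomless Borel probability measure `μ` on a Polish space `X`
and every real number `a` with `0 < a < 1` there exists an injective continuous map
`f : 2^ω → X` such that `μ (f '' B) = a * λ B` for every Borel subset `B ⊆ 2^ω`. -/
theorem stmt3 {X : Type*} [TopologicalSpace X] [PolishSpace X] [MeasurableSpace X]
    [BorelSpace X] (μ : Measure X) (hprob : IsProbabilityMeasure μ)
    (hcont : ∀ x : X, μ {x} = 0) (a : ℝ) (ha0 : 0 < a) (ha1 : a < 1) :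
    ∃ f : (ℕ → ZMod 2) → X, Function.Injective f ∧ Continuous f ∧
      ∀ B : Set (ℕ → ZMod 2), MeasurableSet B →
        μ (f '' B) = ENNReal.ofReal a * cantorHaar B := by
  let := TopologicalSpace.metrizableSpaceMetric X
  obtain ⟨T, hlen, hsub, hsmall⟩ := CompactLevel.exists_sequence hcont ha0
    (by rwa [probReal_univ])
  have hne : ∀ k s, ((T k).piece s).Nonempty := by
    intro k s
    refine nonempty_of_measure_ne_zero (μ := μ) fun h ↦ ?_
    have h1 := (T k).lt_measureReal_piece s
    rw [measureReal_def, h] at h1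
    have : 0 < a / 2 ^ (T k).length := by positivity
    simp at h1
    linarith
  have hf : ∀ x, ∃ y, ∀ k, y ∈ (T k).piece (initialWord _ x) := by
    intro x
    obtain ⟨y, hy⟩ := IsCompact.nonempty_iInter_of_sequence_nonempty_isCompact_isClosed
      (fun k ↦ (T k).piece (initialWord _ x)) (fun k ↦ hsub k x) (fun k ↦ hne k _)
      ((T 0).isCompact_piece _) (fun k ↦ ((T k).isCompact_piece _).isClosed)
    exact ⟨y, mem_iInter.1 hy⟩
  choose f hf using hf
  have hword : ∀ k x z, f x ∈ (T k).piece z → z = initialWord _ x := by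
    intro k x z hz
    by_contra h
    exact disjoint_left.1 ((T k).disjoint_piece h) hz (hf x k)
  have hinj : Function.Injective f := by
    intro x y hxy
    funext i
    have h := hword (i + 1) x _ (hxy ▸ hf y (i + 1))
    exact (congrFun h ⟨i, (Nat.lt_succ_self i).trans_le (hlen.id_le (i + 1))⟩).symm
  have hcts : Continuous f := by
    rw [continuous_iff_continuousAt]
    intro x
    rw [ContinuousAt, Metric.tendsto_nhds]
    intro ε hε
    obtain ⟨k, hk⟩ := hsmall (ε / 2) (half_pos hε)
    have hnhds : initialWord (T k).length ⁻¹' {initialWord _ x} ∈ 𝓝 x :=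
      ((isOpen_discrete _).preimage (continuous_initialWord _)).mem_nhds rfl
    filter_upwards [hnhds] with y hy
    have hy' : initialWord (T k).length y = initialWord _ x := hy
    have := (hk k le_rfl _).1 _ (hy' ▸ hf y k) _ (hf x k)
    linarith
  have hemb : MeasurableEmbedding f := (hcts.isClosedEmbedding hinj).measurableEmbedding
  have hrange : ⋂ k, ⋃ s, (T k).piece s ⊆ range f := by
    intro z hz
    rw [mem_iInter] at hz
    obtain ⟨x, hx⟩ := IsCompact.nonempty_iInter_of_sequence_nonempty_isCompact_isClosed
      (fun k ↦ {x | z ∈ (T k).piece (initialWord _ x)}) (fun k x hx ↦ hsub k x hx)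
      (fun k ↦ by
        obtain ⟨s, hs⟩ := mem_iUnion.1 (hz k)
        obtain ⟨x, rfl⟩ := initialWord_surjective _ s
        exact ⟨x, hs⟩)
      (((isClosed_discrete {s | z ∈ (T 0).piece s}).preimage
        (continuous_initialWord _)).isCompact)
      (fun k ↦ (isClosed_discrete {s | z ∈ (T k).piece s}).preimage (continuous_initialWord _))
    refine ⟨x, eq_of_forall_dist_le fun ε hε ↦ ?_⟩
    obtain ⟨k, hk⟩ := hsmall ε hε
    exact (hk k le_rfl _).1 _ (hf x k) _ (mem_iInter.1 hx k)
  have hmeas : ∀ k, MeasurableSet (⋃ s, (T k).piece s) := fun k ↦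
    MeasurableSet.iUnion fun s ↦ ((T k).isCompact_piece s).measurableSet
  have hlevel : ∀ k, ENNReal.ofReal a ≤ μ (⋃ s, (T k).piece s) := by
    intro k
    rw [ENNReal.ofReal_le_iff_le_toReal (measure_ne_top _ _), ← measureReal_def,
      measureReal_iUnion_fintype (T k).disjoint_piece
        fun s ↦ ((T k).isCompact_piece s).measurableSet]
    refine le_trans ?_ (Finset.sum_le_sum fun s _ ↦ ((T k).lt_measureReal_piece s).le)
    simp [ZMod.card, mul_div_cancel₀]
  have hanti : Antitone fun k ↦ ⋃ s, (T k).piece s := by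
    refine antitone_nat_of_succ_le fun k ↦ iUnion_subset fun s ↦ ?_
    obtain ⟨x, rfl⟩ := initialWord_surjective _ s
    exact (hsub k x).trans (subset_iUnion (T k).piece _)
  have htotal : ENNReal.ofReal a ≤ μ (range f) := by
    refine le_trans ?_ (measure_mono hrange)
    rw [hanti.measure_iInter (fun k ↦ (hmeas k).nullMeasurableSet) ⟨0, measure_ne_top _ _⟩]
    exact le_iInf hlevel
  have : IsFiniteMeasure (μ.comap f) := ⟨by
    rw [hemb.comap_apply]; exact measure_lt_top _ _⟩
  have hν : μ.comap f = ENNReal.ofReal a • cantorHaar := by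
    refine eq_smul_cantorHaar ha0.le ?_ fun ε hε m ↦ ?_
    · rwa [measureReal_def, hemb.comap_apply, image_univ,
        ← ENNReal.ofReal_le_iff_le_toReal (measure_ne_top _ _)]
    · obtain ⟨k, hk⟩ := hsmall ε hε
      refine ⟨(T (max k m)).length, (le_max_right k m).trans (hlen.id_le _), fun s ↦ ?_⟩
      refine le_trans ?_ (hk _ (le_max_left k m) s).2
      rw [measureReal_def, hemb.comap_apply]
      refine measureReal_mono (μ := μ) ?_
      rintro _ ⟨x, rfl, rfl⟩
      exact hf x _
  refine ⟨f, hinj, hcts, fun B _ ↦ ?_⟩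
  rw [← hemb.comap_apply, hν, Measure.smul_apply, smul_eq_mul]
end

section
/- For any compact metrizable space K and any Polish space Y, the set E(K,Y) of injective continuous maps from K to Y is a G_δ-subset of the space C(K,Y) of continuous maps from K to Y endowed with the compact-open topology; moreover, if K is zero-dimensional and Y has no isolated points, then E(K,Y) is dense in C(K,Y). -/
open TopologicalSpace Filter

/-- Maps that separate the points of every pair in a compact set form an open set. -/
theorem ContinuousMap.isOpen_setOf_forall_ne {K Y : Type*} [TopologicalSpace K] [CompactSpace K]
    [T2Space K] [TopologicalSpace Y] [T2Space Y] {A : Set (K × K)} (hA : IsCompact A) :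
    IsOpen {f : C(K, Y) | ∀ p ∈ A, f p.1 ≠ f p.2} := by
  rw [isOpen_iff_eventually]
  intro f hf
  refine hA.eventually_forall_of_forall_eventually fun p hp ↦ ?_
  have hopen : IsOpen {z : C(K, Y) × (K × K) | z.1 z.2.1 ≠ z.1 z.2.2} :=
    isOpen_ne_fun (by fun_prop) (by fun_prop)
  exact hopen.mem_nhds (x := (f, p)) (hf p hp)

/-- Finitely many infinite sets have a system of distinct representatives. -/
theorem Set.exists_injective_forall_mem_of_infinite {ι Y : Type*} [Finite ι] {s : ι → Set Y}
    (hs : ∀ i, (s i).Infinite) : ∃ y : ι → Y, Function.Injective y ∧ ∀ i, y i ∈ s i := by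
  classical
  have := Fintype.ofFinite ι
  choose t hts htc using fun i ↦ (hs i).exists_subset_card_eq (Fintype.card ι)
  obtain ⟨y, hy, hyt⟩ := (Finset.all_card_le_biUnion_card_iff_exists_injective t).1 fun u ↦ by
    obtain rfl | ⟨i, hi⟩ := u.eq_empty_or_nonempty
    · simp
    · calc u.card ≤ (t i).card := (htc i).symm ▸ u.card_le_univ
        _ ≤ (u.biUnion t).card := Finset.card_le_card (Finset.subset_biUnion_of_mem t hi)
  exact ⟨y, hy, fun i ↦ hts i (hyt i)⟩

/-- Maps from a profinite space into a crowded metric space that separate points at distance at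
least `ε` are dense. -/
theorem ContinuousMap.dense_setOf_forall_ne_of_le_dist {K Y : Type*} [MetricSpace K]
    [CompactSpace K] [TotallyDisconnectedSpace K] [MetricSpace Y]
    (hY : ∀ y : Y, (nhdsWithin y {y}ᶜ).NeBot) {ε : ℝ} (hε : 0 < ε) :
    Dense {f : C(K, Y) | ∀ p ∈ {p : K × K | ε ≤ dist p.1 p.2}, f p.1 ≠ f p.2} := by
  intro f
  rw [Metric.mem_closure_iff]
  intro δ hδ
  let η := min (ε / 2) (δ / 2)
  have hη : 0 < η := by positivity
  let F : C(K, K × Y) := (ContinuousMap.id K).prodMk f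
  have hS : {p : (K × Y) × (K × Y) | dist p.1 p.2 < η} ∈ nhdsSet (Set.diagonal (K × Y)) :=
    (isOpen_lt continuous_dist continuous_const).mem_nhdsSet.2 <| by
      rintro ⟨a, b⟩ (rfl : a = b)
      simpa using hη
  obtain ⟨n, g, h, hg, hgh⟩ := F.exists_finite_approximation_of_mem_nhds_diagonal hS
  obtain ⟨y, hy, hyh⟩ := Set.exists_injective_forall_mem_of_infinite fun i ↦
    have := hY (h i).2
    infinite_of_mem_nhds (h i).2 (Metric.ball_mem_nhds (h i).2 hη)
  have hdist (x : K) : dist x (h (g x)).1 < η ∧ dist (f x) (h (g x)).2 < η :=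
    max_lt_iff.1 (hgh x)
  refine ⟨⟨y ∘ g, continuous_of_discreteTopology.comp hg⟩, ?_, ?_⟩
  · rintro ⟨a, b⟩ hab heq
    have hgab : g a = g b := hy heq
    have ha := (hdist a).1
    have hb := (hdist b).1
    rw [← hgab] at hb
    have := dist_triangle_right a b (h (g a)).1
    have : η ≤ ε / 2 := min_le_left _ _
    have : ε ≤ dist a b := hab
    linarith
  · rw [ContinuousMap.dist_lt_iff hδ]
    intro x
    have hx := (hdist x).2
    have hyx : dist (y (g x)) (h (g x)).2 < η := hyh (g x)
    have := dist_triangle_right (f x) (y (g x)) (h (g x)).2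
    have : η ≤ δ / 2 := min_le_right _ _
    change dist (f x) (y (g x)) < δ
    linarith

theorem ContinuousMap.setOf_injective_eq_iInter {K Y : Type*} [MetricSpace K]
    [TopologicalSpace Y] :
    {f : C(K, Y) | Function.Injective f} =
      ⋂ n : ℕ, {f | ∀ p ∈ {p : K × K | 1 / ((n : ℝ) + 1) ≤ dist p.1 p.2}, f p.1 ≠ f p.2} := by
  ext f
  simp only [Set.mem_iInter, Set.mem_ofPred_eq]
  constructor
  · intro hf n p hp heq
    have : (0 : ℝ) < 1 / ((n : ℝ) + 1) := by positivity
    rw [hf heq, dist_self] at hp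
    linarith
  · intro hf a b hab
    by_contra hne
    obtain ⟨n, hn⟩ := exists_nat_one_div_lt (dist_pos.2 hne)
    exact hf n (a, b) hn.le hab

/-- For any compact metrizable space `K` and any Polish space `Y`, the set
`E(K,Y)` of injective continuous maps from `K` to `Y` is a `Gδ`-subset of the space
`C(K,Y)` of continuous maps endowed with the compact-open topology; moreover, if `K` is
zero-dimensional and `Y` has no isolated points, then `E(K,Y)` is dense in `C(K,Y)`. -/
theorem stmt4 {K Y : Type*} [TopologicalSpace K] [CompactSpace K] [MetrizableSpace K]
    [TopologicalSpace Y] [PolishSpace Y] :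
    IsGδ {f : C(K, Y) | Function.Injective ⇑f} ∧
      (IsTopologicalBasis {s : Set K | IsClopen s} →
        (∀ y : Y, (nhdsWithin y {y}ᶜ).NeBot) →
        Dense {f : C(K, Y) | Function.Injective ⇑f}) := by
  let _ := metrizableSpaceMetric K
  let _ := upgradeIsCompletelyMetrizable Y
  have hopen (n : ℕ) : IsOpen {f : C(K, Y) |
      ∀ p ∈ {p : K × K | 1 / ((n : ℝ) + 1) ≤ dist p.1 p.2}, f p.1 ≠ f p.2} :=
    ContinuousMap.isOpen_setOf_forall_ne (isClosed_le continuous_const continuous_dist).isCompact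
  rw [ContinuousMap.setOf_injective_eq_iInter]
  refine ⟨IsGδ.iInter_of_isOpen hopen, fun hK hY ↦ ?_⟩
  have := totallySeparatedSpace_of_t0_of_basis_clopen hK
  exact dense_iInter_of_isOpen hopen fun n ↦
    ContinuousMap.dense_setOf_forall_ne_of_le_dist hY (by positivity)
end

section
/- For any nonempty analytic subspace 𝒦 of the hyperspace 𝒦(ℝ^ω) of nonempty compact subsets of ℝ^ω (endowed with the Vietoris topology), there exists a closed set F ⊆ ℝ^ω such that: (1) for any K ∈ 𝒦 there exists x ∈ ℝ^ω with K + x ⊆ F; and (2) for any x ∈ ℝ^ω the intersection F ∩ (x + [0,1]^ω) is contained in K + d for some K ∈ 𝒦 and some d ∈ ℝ^ω. -/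
open MeasureTheory TopologicalSpace

/-- A fixed compatible metric on the Polish space `ℝ^ω`; it induces (definitionally) the
product topology, and it endows the hyperspace of nonempty compact subsets of `ℝ^ω` with
the Hausdorff-metric (Vietoris) topology. -/
noncomputable instance : MetricSpace (ℕ → ℝ) := TopologicalSpace.metrizableSpaceMetric _

/-- Translating a subset of `[-k, k]` by `translation k` yields intervals at mutual distance at
least `2`. -/
def translation (k : ℕ) : ℝ := ((k : ℝ) + 1) ^ 2

theorem eq_of_abs_sub_translation_le {k l : ℕ} {a b : ℝ} (ha : |a - translation k| ≤ k)
    (hb : |b - translation l| ≤ l) (hab : |a - b| ≤ 1) : k = l := by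
  unfold translation at ha hb
  rw [abs_le] at ha hb hab
  rcases lt_trichotomy k l with h | h | h
  · have h' : (k : ℝ) + 1 ≤ l := by exact_mod_cast h
    nlinarith [Nat.cast_nonneg (α := ℝ) k]
  · exact h
  · have h' : (l : ℝ) + 1 ≤ k := by exact_mod_cast h
    nlinarith [Nat.cast_nonneg (α := ℝ) l]

theorem isClosed_setOf_mem_nonemptyCompacts {X : Type*} [MetricSpace X] :
    IsClosed {p : X × NonemptyCompacts X | p.1 ∈ (p.2 : Set X)} := by
  have h : Continuous fun p : X × NonemptyCompacts X =>
      Metric.infEDist p.1 (p.2.toCloseds : Set X) :=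
    Closeds.continuous_infEDist.comp
      (continuous_fst.prodMk (NonemptyCompacts.continuous_toCloseds.comp continuous_snd))
  convert isClosed_singleton (x := (0 : ENNReal)) |>.preimage h using 1
  ext p
  exact Metric.mem_iff_infEDist_zero_of_closed p.2.isCompact.isClosed

/-- The pieces of the family `f` cut down by the bounds `γ` and moved apart. The sequence `γ`
codes both the index of the piece and the bounds. -/
def translatedPiece (f : (ℕ → ℕ) → NonemptyCompacts (ℕ → ℝ)) (γ : ℕ → ℕ) : Set (ℕ → ℝ) :=
  {y | (fun n => y n - translation (γ n)) ∈ (f fun n => (γ n).unpair.1 : Set (ℕ → ℝ)) ∧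
    ∀ n, |y n - translation (γ n)| ≤ γ n}

theorem eq_of_mem_translatedPiece {f : (ℕ → ℕ) → NonemptyCompacts (ℕ → ℝ)} {γ δ : ℕ → ℕ}
    {y z : ℕ → ℝ} (hy : y ∈ translatedPiece f γ) (hz : z ∈ translatedPiece f δ) {n : ℕ}
    (h : |y n - z n| ≤ 1) : γ n = δ n :=
  eq_of_abs_sub_translation_le (hy.2 n) (hz.2 n) h

theorem isClosed_setOf_mem_translatedPiece {f : (ℕ → ℕ) → NonemptyCompacts (ℕ → ℝ)}
    (hf : Continuous f) :
    IsClosed {p : (ℕ → ℕ) × (ℕ → ℝ) | p.2 ∈ translatedPiece f p.1} := by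
  have hγ (n : ℕ) : Continuous fun p : (ℕ → ℕ) × (ℕ → ℝ) => p.1 n := by fun_prop
  have ht (n : ℕ) : Continuous fun p : (ℕ → ℕ) × (ℕ → ℝ) => p.2 n - translation (p.1 n) :=
    ((continuous_apply n).comp continuous_snd).sub
      ((continuous_of_discreteTopology (f := translation)).comp (hγ n))
  refine IsClosed.and ?_ ?_
  · refine isClosed_setOf_mem_nonemptyCompacts.preimage
      ((continuous_pi ht).prodMk (hf.comp (continuous_pi fun n => ?_)))
    exact (continuous_of_discreteTopology (f := fun k : ℕ => k.unpair.1)).comp (hγ n)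
  · simp only [Set.ofPred_forall]
    exact isClosed_iInter fun n => isClosed_le (ht n).abs
      ((continuous_of_discreteTopology (f := fun k : ℕ => (k : ℝ))).comp (hγ n))

theorem isClosed_iUnion_translatedPiece {f : (ℕ → ℕ) → NonemptyCompacts (ℕ → ℝ)}
    (hf : Continuous f) : IsClosed (⋃ γ, translatedPiece f γ) := by
  refine IsSeqClosed.isClosed fun u y hu hy => ?_
  choose γ hγ using fun j => Set.mem_iUnion.1 (hu j)
  have hcoord (n : ℕ) : ∃ k, ∀ᶠ j in Filter.atTop, γ j n = k := by
    have h1 := Metric.cauchySeq_iff.1 (tendsto_pi_nhds.1 hy n).cauchySeq 1 one_pos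
    obtain ⟨N, hN⟩ := h1
    refine ⟨γ N n, Filter.eventually_atTop.2 ⟨N, fun j hj => ?_⟩⟩
    refine eq_of_mem_translatedPiece (hγ j) (hγ N) ?_
    rw [← Real.dist_eq]
    exact (hN j hj N le_rfl).le
  choose δ hδ using hcoord
  have hlim : Filter.Tendsto γ Filter.atTop (nhds δ) :=
    tendsto_pi_nhds.2 fun n => tendsto_nhds_of_eventually_eq (hδ n)
  exact Set.mem_iUnion.2 ⟨δ, (isClosed_setOf_mem_translatedPiece hf).mem_of_tendsto
    (hlim.prodMk_nhds hy) (Filter.Eventually.of_forall hγ)⟩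

/-- For any nonempty analytic subspace `𝒦` of the hyperspace of nonempty
compact subsets of `ℝ^ω` there exists a closed set `F ⊆ ℝ^ω` such that (1) every `K ∈ 𝒦`
has a translate `K + x` contained in `F`, and (2) for every `x ∈ ℝ^ω` the intersection
`F ∩ (x + [0,1]^ω)` is contained in `K + d` for some `K ∈ 𝒦` and `d ∈ ℝ^ω`. -/
theorem stmt5 (𝒦 : Set (NonemptyCompacts (ℕ → ℝ))) (hne : 𝒦.Nonempty)
    (h𝒦 : AnalyticSet 𝒦) :
    ∃ F : Set (ℕ → ℝ), IsClosed F ∧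
      (∀ K ∈ 𝒦, ∃ x : ℕ → ℝ, (· + x) '' (K : Set (ℕ → ℝ)) ⊆ F) ∧
      (∀ x : ℕ → ℝ, ∃ K ∈ 𝒦, ∃ d : ℕ → ℝ,
        F ∩ ((x + ·) '' Set.univ.pi fun _ : ℕ => Set.Icc (0 : ℝ) 1) ⊆
          (· + d) '' (K : Set (ℕ → ℝ))) := by
  rw [AnalyticSet] at h𝒦
  obtain ⟨f, hf, rfl⟩ := h𝒦.resolve_left hne.ne_empty
  refine ⟨⋃ γ, translatedPiece f γ, isClosed_iUnion_translatedPiece hf, ?_, fun x => ?_⟩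
  · rintro _ ⟨α, rfl⟩
    have hbound (n : ℕ) : ∃ b : ℕ, ∀ z ∈ (f α : Set (ℕ → ℝ)), |z n| ≤ b := by
      obtain ⟨C, hC⟩ := (f α).isCompact.exists_bound_of_continuousOn
        (f := fun z : ℕ → ℝ => z n) (continuous_apply n).continuousOn
      obtain ⟨b, hb⟩ := exists_nat_ge C
      exact ⟨b, fun z hz => (hC z hz).trans hb⟩
    choose b hb using hbound
    refine ⟨fun n => translation (Nat.pair (α n) (b n)), ?_⟩
    rintro _ ⟨z, hz, rfl⟩
    refine Set.mem_iUnion.2 ⟨fun n => Nat.pair (α n) (b n), ?_, fun n => ?_⟩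
    · simpa using hz
    · simpa using (hb n z hz).trans (Nat.cast_le.2 (Nat.right_le_pair (α n) (b n)))
  · by_cases hex : ((⋃ γ, translatedPiece f γ) ∩
        ((x + ·) '' Set.univ.pi fun _ : ℕ => Set.Icc (0 : ℝ) 1)).Nonempty
    · obtain ⟨_, hy, y, hyI, rfl⟩ := hex
      obtain ⟨γ, hγ⟩ := Set.mem_iUnion.1 hy
      refine ⟨_, Set.mem_range_self fun n => (γ n).unpair.1, fun n => translation (γ n), ?_⟩
      rintro _ ⟨hz, z, hzI, rfl⟩
      obtain ⟨δ, hδ⟩ := Set.mem_iUnion.1 hz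
      have hδγ : δ = γ := by
        funext n
        refine eq_of_mem_translatedPiece hδ hγ ?_
        have hy01 := hyI n trivial
        have hz01 := hzI n trivial
        simp only [Pi.add_apply, add_sub_add_left_eq_sub]
        rw [abs_le]
        constructor <;> linarith [hy01.1, hy01.2, hz01.1, hz01.2]
      subst hδγ
      exact ⟨_, hδ.1, by funext n; simp⟩
    · obtain ⟨K, hK⟩ := hne
      refine ⟨K, hK, 0, ?_⟩
      rw [Set.not_nonempty_iff_eq_empty.1 hex]
      exact Set.empty_subset _
end

section
/- The abelian Polish group ℝ^ω contains a closed subset F which is strongly Haar-meager but not injectively Haar-meager; that is, there exists a nonempty compact set K ⊆ ℝ^ω such that K ∩ (F + x) is meager in K for every x ∈ ℝ^ω, but for every injective continuous map f : 2^ω → ℝ^ω there exists x ∈ ℝ^ω such that f⁻¹(F + x) is non-meager in 2^ω. -/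
open Set Filter Topology

/-- Every line parallel to the zeroth axis leaves `V` somewhere above the interval `[a, b]`. -/
def AvoidsOver (a b : ℝ) (V : Set (ℕ → ℝ)) : Prop :=
  ∀ z : ℕ → ℝ, ∃ t ∈ Icc a b, Function.update z 0 t ∉ V

/-- The translation vector whose coordinates encode the sequence `n`. -/
def codeVector (n : ℕ → ℕ) : ℕ → ℝ
  | 0 => 0
  | k + 1 => (n k : ℝ) * (n k + 1)

lemma continuous_const_update (z : ℕ → ℝ) (i : ℕ) :
    Continuous fun t : ℝ => Function.update z i t :=
  (continuous_const (y := z)).update i continuous_id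

lemma code_unique {m m' : ℕ} {u v : ℝ} (hu : |u - (m : ℝ) * (m + 1)| ≤ m)
    (hv : |v - (m' : ℝ) * (m' + 1)| ≤ m') (huv : |u - v| < 1) : m = m' := by
  rw [abs_le] at hu hv
  rw [abs_lt] at huv
  rcases lt_trichotomy m m' with h | h | h
  · have h' : (m : ℝ) + 1 ≤ m' := by exact_mod_cast h
    nlinarith [(Nat.cast_nonneg m : (0 : ℝ) ≤ m)]
  · exact h
  · have h' : (m' : ℝ) + 1 ≤ m := by exact_mod_cast h
    nlinarith [(Nat.cast_nonneg m' : (0 : ℝ) ≤ m')]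

/-- The union over all codes `n` of the set `⋂ k, V k (n k)`, cut down to a box whose size is
given by `n` and translated by `codeVector n`. -/
def codedUnion (V : ℕ → ℕ → Set (ℕ → ℝ)) : Set (ℕ → ℝ) :=
  {z | ∃ n : ℕ → ℕ, (∀ k, |z (k + 1) - (n k : ℝ) * (n k + 1)| ≤ n k) ∧
    ∀ k, z - codeVector n ∈ V k (n k)}

lemma isClosed_codedUnion {V : ℕ → ℕ → Set (ℕ → ℝ)} (hV : ∀ k m, IsClosed (V k m)) :
    IsClosed (codedUnion V) := by
  rw [← isSeqClosed_iff_isClosed]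
  intro z w hz hzw
  choose n hn hnV using hz
  have hcoord : ∀ i, Tendsto (fun j => z j i) atTop (𝓝 (w i)) := tendsto_pi_nhds.1 hzw
  have hconst : ∀ k, ∃ m, ∀ᶠ j in atTop, n j k = m := by
    intro k
    have hclose : ∀ᶠ j in atTop, |z j (k + 1) - w (k + 1)| < 1 / 2 := by
      have := Metric.tendsto_nhds.1 (hcoord (k + 1)) (1 / 2) (by norm_num)
      simpa only [Real.dist_eq] using this
    obtain ⟨j₀, hj₀⟩ := eventually_atTop.1 hclose
    refine ⟨n j₀ k, eventually_atTop.2 ⟨j₀, fun j hj => ?_⟩⟩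
    refine code_unique (hn j k) (hn j₀ k) ?_
    have h1 := abs_lt.1 (hj₀ j hj)
    have h2 := abs_lt.1 (hj₀ j₀ le_rfl)
    rw [abs_lt]
    constructor <;> linarith
  choose N hN using hconst
  have hcode : Tendsto (fun j => codeVector (n j)) atTop (𝓝 (codeVector N)) := by
    refine tendsto_pi_nhds.2 fun i => ?_
    cases i with
    | zero => exact tendsto_const_nhds
    | succ k =>
      refine tendsto_const_nhds.congr' ?_
      filter_upwards [hN k] with j hj
      simp [codeVector, hj]
  refine ⟨N, fun k => ?_, fun k => ?_⟩
  · refine le_of_tendsto (((hcoord (k + 1)).sub_const _).abs) ?_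
    filter_upwards [hN k] with j hj
    simpa [hj] using hn j k
  · refine (hV k (N k)).mem_of_tendsto (hzw.sub hcode) ?_
    filter_upwards [hN k] with j hj
    simpa [hj] using hnV j k

/-- In a regular second countable space, countably many closed sets interpolate between
compact sets and their open neighbourhoods. -/
lemma exists_countable_closed_interpolation (X : Type*) [TopologicalSpace X] [RegularSpace X]
    [SecondCountableTopology X] :
    ∃ 𝒱 : Set (Set X), 𝒱.Countable ∧ ∅ ∈ 𝒱 ∧ (∀ V ∈ 𝒱, IsClosed V) ∧
      ∀ C U : Set X, IsCompact C → IsOpen U → C ⊆ U → ∃ V ∈ 𝒱, C ⊆ V ∧ V ⊆ U := by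
  set B := TopologicalSpace.countableBasis X
  have hB := TopologicalSpace.isBasis_countableBasis X
  refine ⟨(fun T => closure (⋃₀ T)) '' {T | T.Finite ∧ T ⊆ B}, ?_, ?_, ?_, ?_⟩
  · exact (countable_ofPred_finite_subset (TopologicalSpace.countable_countableBasis X)).image _
  · exact ⟨∅, ⟨finite_empty, empty_subset _⟩, by simp⟩
  · rintro _ ⟨T, -, rfl⟩
    exact isClosed_closure
  · intro C U hC hU hCU
    rw [exists_mem_image]
    refine hC.induction_on (p := fun s => ∃ T ∈ {T : Set (Set X) | T.Finite ∧ T ⊆ B},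
      s ⊆ closure (⋃₀ T) ∧ closure (⋃₀ T) ⊆ U) ?_ ?_ ?_ ?_
    · exact ⟨∅, ⟨finite_empty, empty_subset _⟩, by simp⟩
    · rintro s t hst ⟨T, hT, h1, h2⟩
      exact ⟨T, hT, hst.trans h1, h2⟩
    · rintro s t ⟨T, hT, h1, h2⟩ ⟨S, hS, h3, h4⟩
      refine ⟨T ∪ S, ⟨hT.1.union hS.1, union_subset hT.2 hS.2⟩, ?_⟩
      rw [sUnion_union, closure_union]
      exact ⟨union_subset_union h1 h3, union_subset h2 h4⟩
    · intro x hx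
      obtain ⟨W, hWB, hxW, hWU⟩ := hB.exists_closure_subset (hU.mem_nhds (hCU hx))
      refine ⟨W, mem_nhdsWithin_of_mem_nhds ((hB.isOpen hWB).mem_nhds hxW), {W},
        ⟨finite_singleton _, by simpa using hWB⟩, ?_⟩
      rw [sUnion_singleton]
      exact ⟨subset_closure, hWU⟩

lemma AvoidsOver.mono {a b : ℝ} {V W : Set (ℕ → ℝ)} (hW : AvoidsOver a b W) (h : V ⊆ W) :
    AvoidsOver a b V := fun z =>
  let ⟨t, ht, hz⟩ := hW z
  ⟨t, ht, fun hV => hz (h hV)⟩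

lemma AvoidsOver.exists_isOpen {a b : ℝ} {C : Set (ℕ → ℝ)} (hC : IsClosed C) (hab : a ≤ b)
    (h : AvoidsOver a b C) : ∃ U, IsOpen U ∧ C ⊆ U ∧ AvoidsOver a b U := by
  let _ : MetricSpace (ℕ → ℝ) := TopologicalSpace.metrizableSpaceMetric (ℕ → ℝ)
  rcases C.eq_empty_or_nonempty with rfl | hne
  · exact ⟨∅, isOpen_empty, Subset.rfl, h⟩
  have hd : Continuous fun z : ℕ → ℝ => Metric.infDist z C := Metric.continuous_infDist_pt C
  have hupd : Continuous fun p : (ℕ → ℝ) × ℝ => Function.update p.1 0 p.2 :=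
    continuous_fst.update 0 continuous_snd
  refine ⟨{z | ∀ t ∈ Icc a b,
    Metric.infDist (Function.update z 0 t) C ≤ Metric.infDist z C}ᶜ, ?_, ?_, ?_⟩
  · rw [isOpen_compl_iff]
    simp only [ofPred_forall]
    refine isClosed_biInter fun t _ => isClosed_le ?_ hd
    exact hd.comp (hupd.comp (continuous_id.prodMk continuous_const))
  · intro z hz hz'
    obtain ⟨t, ht, hzt⟩ := h z
    have h1 := hz' t ht
    rw [Metric.infDist_zero_of_mem hz] at h1
    exact hzt ((hC.mem_iff_infDist_zero hne).2 (le_antisymm h1 Metric.infDist_nonneg))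
  · intro z
    obtain ⟨t, ht, hmax⟩ := (isCompact_Icc (a := a) (b := b)).exists_isMaxOn
      (nonempty_Icc.2 hab)
      (hd.comp (hupd.comp (continuous_const.prodMk continuous_id))).continuousOn (f := fun t =>
        Metric.infDist (Function.update z 0 t) C)
    refine ⟨t, ht, fun hU => hU fun s hs => ?_⟩
    rw [Function.update_idem]
    exact hmax hs

lemma avoidsOver_range {Y : Type*} [TopologicalSpace Y] [CompactSpace Y]
    [TotallyDisconnectedSpace Y] {f : Y → ℕ → ℝ} (hf : Continuous f)
    (hinj : Function.Injective f) {a b : ℝ} (hab : a < b) : AvoidsOver a b (range f) := by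
  intro z
  by_contra! hcon
  have hemb := hf.isClosedEmbedding hinj
  set S : Set (ℕ → ℝ) := (fun t => Function.update z 0 t) '' Icc a b
  have hS : IsPreconnected S :=
    isPreconnected_Icc.image _ (continuous_const_update z 0).continuousOn
  have hSf : S ⊆ range f := by
    rintro _ ⟨t, ht, rfl⟩
    exact hcon t ht
  have hpre : IsPreconnected (f ⁻¹' S) := by
    rw [← hemb.isInducing.isPreconnected_image, image_preimage_eq_of_subset hSf]
    exact hS
  obtain ⟨y, hy⟩ := hcon a (left_mem_Icc.2 hab.le)
  obtain ⟨y', hy'⟩ := hcon b (right_mem_Icc.2 hab.le)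
  have hyy : y = y' := hpre.subsingleton (by
      rw [mem_preimage, hy]; exact ⟨a, left_mem_Icc.2 hab.le, rfl⟩) (by
      rw [mem_preimage, hy']; exact ⟨b, right_mem_Icc.2 hab.le, rfl⟩)
  have : a = b := by
    have := congrFun (hy.symm.trans (hyy ▸ hy')) 0
    simpa using this
  exact hab.ne this

lemma exists_avoidsOver_family {a b : ℝ} (hab : a ≤ b) :
    ∃ V : ℕ → Set (ℕ → ℝ), (∀ m, IsClosed (V m) ∧ AvoidsOver a b (V m)) ∧
      ∀ C, IsCompact C → AvoidsOver a b C → ∀ r : ℝ, ∃ m : ℕ, r ≤ m ∧ C ⊆ V m := by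
  obtain ⟨𝒱, hcount, hempty, hclosed, hinter⟩ := exists_countable_closed_interpolation (ℕ → ℝ)
  obtain ⟨e, he⟩ := (hcount.mono (sep_subset 𝒱 (AvoidsOver a b))).exists_eq_range
    ⟨∅, hempty, fun _ => ⟨a, left_mem_Icc.2 hab, notMem_empty _⟩⟩
  refine ⟨fun m => e m.unpair.1, fun m => ?_, fun C hC hCa r => ?_⟩
  · have hm : e m.unpair.1 ∈ {V ∈ 𝒱 | AvoidsOver a b V} := he ▸ mem_range_self _
    exact ⟨hclosed _ hm.1, hm.2⟩
  · obtain ⟨U, hU, hCU, hUa⟩ := hCa.exists_isOpen hC.isClosed hab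
    obtain ⟨V, hV, hCV, hVU⟩ := hinter C U hC hU hCU
    have hVe : V ∈ range e := he ▸ ⟨hV, hUa.mono hVU⟩
    obtain ⟨i, rfl⟩ := hVe
    obtain ⟨j, hj⟩ := exists_nat_ge r
    refine ⟨Nat.pair i j, hj.trans (by exact_mod_cast Nat.right_le_pair i j), ?_⟩
    simpa using hCV

lemma exists_add_mem_codedUnion {V : ℕ → ℕ → Set (ℕ → ℝ)} {C : Set (ℕ → ℝ)} (hC : IsCompact C)
    (hV : ∀ k, ∀ r : ℝ, ∃ m : ℕ, r ≤ m ∧ C ⊆ V k m) :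
    ∃ x : ℕ → ℝ, ∀ z ∈ C, z + x ∈ codedUnion V := by
  have hbound : ∀ k : ℕ, ∃ r : ℝ, ∀ z ∈ C, |z (k + 1)| ≤ r := fun k =>
    hC.exists_bound_of_continuousOn (f := fun z : ℕ → ℝ => z (k + 1))
      (continuous_apply _).continuousOn
  choose r hr using hbound
  choose n hn using fun k => hV k (r k)
  refine ⟨codeVector n, fun z hz => ⟨n, fun k => ?_, fun k => ?_⟩⟩
  · simpa [codeVector] using (hr k z hz).trans (hn k).1
  · simpa using (hn k).2 hz

lemma exists_update_notMem_codedUnion {V : ℕ → ℕ → Set (ℕ → ℝ)}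
    (hV : ∀ a b : ℝ, a < b → ∃ k, ∀ m, AvoidsOver a b (V k m)) (z : ℕ → ℝ) {a b : ℝ}
    (hab : a < b) : ∃ t ∈ Icc a b, Function.update z 0 t ∉ codedUnion V := by
  by_contra! hcon
  obtain ⟨n, hn, -⟩ := hcon a (left_mem_Icc.2 hab.le)
  obtain ⟨k, hk⟩ := hV a b hab
  obtain ⟨t, ht, htV⟩ := hk (n k) (z - codeVector n)
  obtain ⟨n', hn', hV'⟩ := hcon t ht
  have hnn : n' = n := funext fun i => code_unique (hn' i) (hn i) (by simp)
  subst hnn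
  refine htV ?_
  convert hV' k using 1
  ext i
  cases i <;> simp [codeVector]

lemma isMeagre_segment {F : Set (ℕ → ℝ)} (hF : IsClosed F)
    (h : ∀ (z : ℕ → ℝ) (a b : ℝ), a < b → ∃ t ∈ Icc a b, Function.update z 0 t ∉ F)
    (x : ℕ → ℝ) :
    IsMeagre {q : (Function.update (0 : ℕ → ℝ) 0 '' Icc 0 1 : Set (ℕ → ℝ)) |
      (q : ℕ → ℝ) ∈ (· + x) '' F} := by
  have hmem : ∀ z, z ∈ (· + x) '' F ↔ z - x ∈ F := fun z => by
    simp [image_add_right, sub_eq_add_neg]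
  simp only [hmem]
  set A : Set (Function.update (0 : ℕ → ℝ) 0 '' Icc 0 1 : Set (ℕ → ℝ)) :=
    {q | (q : ℕ → ℝ) - x ∈ F}
  have hA : IsClosed A := hF.preimage (continuous_subtype_val.sub continuous_const)
  refine IsNowhereDense.isMeagre (hA.isNowhereDense_iff.2 ?_)
  let g : Icc (0 : ℝ) 1 → (Function.update (0 : ℕ → ℝ) 0 '' Icc 0 1 : Set (ℕ → ℝ)) :=
    fun t => ⟨Function.update 0 0 t, t, t.2, rfl⟩
  have hg : Continuous g :=
    ((continuous_const_update 0 0).comp continuous_subtype_val).subtype_mk _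
  by_contra hne
  obtain ⟨⟨_, t, ht, rfl⟩, hq⟩ := nonempty_iff_ne_empty.2 hne
  have hO : g ⁻¹' interior A ∈ 𝓝 (⟨t, ht⟩ : Icc (0 : ℝ) 1) :=
    (isOpen_interior.preimage hg).mem_nhds hq
  obtain ⟨ε, hε, hball⟩ := Metric.mem_nhds_iff.1 hO
  have hab : max 0 (t - ε / 2) < min 1 (t + ε / 2) := by
    simp only [lt_min_iff, max_lt_iff]
    refine ⟨⟨one_pos, ?_⟩, ?_, ?_⟩ <;> linarith [ht.1, ht.2]
  obtain ⟨s, hs, hsF⟩ := h (-x) (max 0 (t - ε / 2) - x 0) (min 1 (t + ε / 2) - x 0)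
    (by linarith)
  obtain ⟨h1, h2⟩ := hs
  have h3 : max 0 (t - ε / 2) ≤ s + x 0 := by linarith
  have h4 : s + x 0 ≤ min 1 (t + ε / 2) := by linarith
  rw [max_le_iff] at h3
  rw [le_min_iff] at h4
  have hsA : g ⟨s + x 0, h3.1, h4.1⟩ ∈ A := by
    refine interior_subset (hball ?_)
    rw [Metric.mem_ball, Subtype.dist_eq, Real.dist_eq, abs_lt]
    constructor <;> dsimp only <;> linarith [h3.2, h4.2]
  refine hsF ?_
  convert (show (g ⟨s + x 0, h3.1, h4.1⟩ : ℕ → ℝ) - x ∈ F from hsA) using 1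
  ext i
  cases i <;> simp [g]

/-- The abelian Polish group `ℝ^ω` contains a closed subset `F` which is
strongly Haar-meager but not injectively Haar-meager: there is a nonempty compact set
`K ⊆ ℝ^ω` such that `K ∩ (F + x)` is meager in `K` for every `x`, but for every injective
continuous map `f : 2^ω → ℝ^ω` there exists `x` such that `f ⁻¹' (F + x)` is non-meager
in the Cantor cube `2^ω`. -/
theorem stmt6 :
    ∃ F : Set (ℕ → ℝ), IsClosed F ∧
      (∃ K : Set (ℕ → ℝ), K.Nonempty ∧ IsCompact K ∧
        ∀ x : ℕ → ℝ, IsMeagre {q : K | (q : ℕ → ℝ) ∈ (· + x) '' F}) ∧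
      (∀ f : (ℕ → Bool) → (ℕ → ℝ), Function.Injective f → Continuous f →
        ∃ x : ℕ → ℝ, ¬ IsMeagre (f ⁻¹' ((· + x) '' F))) := by
  have : Nonempty {p : ℚ × ℚ // p.1 < p.2} := ⟨⟨(0, 1), zero_lt_one⟩⟩
  obtain ⟨e, he⟩ := exists_surjective_nat {p : ℚ × ℚ // p.1 < p.2}
  have hlt : ∀ k, ((e k).1.1 : ℝ) < (e k).1.2 := fun k => by exact_mod_cast (e k).2
  choose V hV hcover using fun k => exists_avoidsOver_family (hlt k).le
  have hclosed := isClosed_codedUnion fun k m => (hV k m).1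
  have hVab : ∀ a b : ℝ, a < b → ∃ k, ∀ m, AvoidsOver a b (V k m) := by
    intro a b hab
    obtain ⟨p, hap, hpb⟩ := exists_rat_btwn hab
    obtain ⟨q, hpq, hqb⟩ := exists_rat_btwn hpb
    obtain ⟨k, hk⟩ := he ⟨(p, q), by exact_mod_cast hpq⟩
    refine ⟨k, fun m z => ?_⟩
    obtain ⟨t, ht, hz⟩ := (hV k m).2 z
    rw [hk] at ht
    exact ⟨t, ⟨hap.le.trans ht.1, ht.2.trans hqb.le⟩, hz⟩
  refine ⟨codedUnion V, hclosed, ⟨Function.update (0 : ℕ → ℝ) 0 '' Icc 0 1,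
    (nonempty_Icc.2 zero_le_one).image _,
    isCompact_Icc.image (continuous_const_update 0 0), isMeagre_segment hclosed
      fun z _ _ hab => exists_update_notMem_codedUnion hVab z hab⟩, fun f hinj hf => ?_⟩
  obtain ⟨x, hx⟩ := exists_add_mem_codedUnion (V := V) (isCompact_range hf) fun k r =>
    hcover k _ (isCompact_range hf) (avoidsOver_range hf hinj (hlt k)) r
  refine ⟨-x, ?_⟩
  have huniv : f ⁻¹' ((· + -x) '' codedUnion V) = univ :=
    eq_univ_of_forall fun y => ⟨f y + x, hx _ (mem_range_self y), by simp⟩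
  rw [huniv]
  exact not_isMeagre_of_isOpen isOpen_univ univ_nonempty
end

section
/- Let X be an abelian topological group whose topology is generated by a complete invariant metric. A subset A of X is Haar-open if and only if for every nonempty compact set K ⊆ X there exists x ∈ X such that the set K ∩ (A + x) has nonempty interior in K. -/
/-- In a complete normed group, if every nonempty compact set `S` has a translate of `A` containing
a nonempty relatively open subset of `S`, then every compact set has, at each of its points, a
translate of `A` which is a relative neighborhood of that point. -/
theorem exists_translate_mem_nhds_of_interior_nonempty {E : Type*} [NormedAddCommGroup E]
    [CompleteSpace E] {A : Set E}
    (h : ∀ K : Set E, IsCompact K → K.Nonempty → ∃ x : E,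
      (interior {q : K | (q : E) ∈ (· + x) '' A}).Nonempty)
    {K : Set E} (hK : IsCompact K) (p : K) :
    ∃ x : E, {q : K | (q : E) ∈ (· + x) '' A} ∈ nhds p := by
  let L : ℕ → Set E := fun n ↦
    (Homeomorph.addRight (p : E)) ⁻¹' K ∩ Metric.closedBall 0 ((1 / 2) ^ n)
  have hL : ∀ n, IsCompact (L n) := fun n ↦
    ((Homeomorph.addRight (p : E)).isCompact_preimage.2 hK).inter_right Metric.isClosed_closedBall
  have hbound : ∀ n, ∀ y ∈ L n, ‖y‖ ≤ (1 / 2) ^ n := fun n y hy ↦ by simpa using hy.2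
  have hzero : ∀ n, (0 : E) ∈ L n := fun n ↦ by simp [L]
  have hsum : Summable fun n : ℕ ↦ ((1 : ℝ) / 2) ^ n := summable_geometric_two
  let T : Set (ℕ → E) := Set.univ.pi L
  let f : (ℕ → E) → E := fun a ↦ ∑' n, a n
  have hf : ContinuousOn f T := continuousOn_tsum
    (fun n ↦ (continuous_apply n).continuousOn) hsum fun n a ha ↦ hbound n _ (ha n trivial)
  obtain ⟨x, ⟨_, a, haT, rfl⟩, hq⟩ := h (f '' T) ((isCompact_univ_pi hL).image_of_continuousOn hf)
    ⟨f 0, 0, fun n _ ↦ hzero n, rfl⟩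
  rw [mem_interior_iff_mem_nhds, Metric.mem_nhds_iff] at hq
  obtain ⟨ε, hε, hball⟩ := hq
  obtain ⟨N, hN⟩ := exists_pow_lt_of_lt_one (half_pos hε) (one_half_lt_one (α := ℝ))
  have hasum : Summable a := .of_norm_bounded hsum fun n ↦ hbound n _ (haT n trivial)
  have key : ∀ y ∈ L N, y - a N + f a ∈ (· + x) '' A := by
    intro y hy
    have hmem : y - a N + f a ∈ f '' T :=
      ⟨Function.update a N y, (Set.update_mem_pi_iff_of_mem haT).2 fun _ ↦ hy,
        (hasum.hasSum.update N y).tsum_eq⟩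
    refine @hball ⟨_, hmem⟩ ?_
    rw [Metric.mem_ball, Subtype.dist_eq, dist_eq_norm, add_sub_cancel_right]
    linarith [norm_sub_le y (a N), hbound N y hy, hbound N _ (haT N trivial)]
  refine ⟨x - f a + a N + p, Metric.mem_nhds_iff.2 ⟨(1 / 2) ^ N, by positivity, fun q hq ↦ ?_⟩⟩
  have hqL : (q : E) - p ∈ L N := by
    refine ⟨by simp, ?_⟩
    rw [mem_closedBall_zero_iff, ← dist_eq_norm]
    exact (Metric.mem_ball.1 hq).le
  obtain ⟨b, hb, hbq⟩ := key _ hqL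
  refine ⟨b, hb, ?_⟩
  have : b = (q : E) - p - a N + f a - x := eq_sub_of_add_eq hbq
  simp only [this]
  abel

/-- Let `X` be an abelian group whose topology is generated by a complete
invariant metric. A subset `A ⊆ X` is Haar-open (for every compact `K ⊆ X` and every
`p ∈ K` there is `x ∈ X` such that `K ∩ (A + x)` is a neighborhood of `p` in `K`) if and
only if for every nonempty compact set `K ⊆ X` there exists `x ∈ X` such that
`K ∩ (A + x)` has nonempty interior in `K`. -/
theorem stmt7 {X : Type*} [MetricSpace X] [AddCommGroup X] [CompleteSpace X]
    (hinv : ∀ a b x : X, dist (a + x) (b + x) = dist a b) (A : Set X) :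
    (∀ K : Set X, IsCompact K → ∀ p : K, ∃ x : X,
        {q : K | (q : X) ∈ (· + x) '' A} ∈ nhds p) ↔
      (∀ K : Set X, IsCompact K → K.Nonempty → ∃ x : X,
        (interior {q : K | (q : X) ∈ (· + x) '' A}).Nonempty) := by
  refine ⟨fun h K hK ⟨p, hp⟩ ↦ ?_, fun h K hK p ↦ ?_⟩
  · obtain ⟨x, hx⟩ := h K hK ⟨p, hp⟩
    exact ⟨x, _, mem_interior_iff_mem_nhds.2 hx⟩
  · let : Norm X := ⟨fun x ↦ dist 0 x⟩
    let : NormedAddCommGroup X := .ofAddDist (fun _ ↦ rfl) fun a b x ↦ by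
      rw [add_comm x a, add_comm x b, hinv]
    exact exists_translate_mem_nhds_of_interior_nonempty h hK p
end

section
/- The Polish group ℤ^ω (the countable product of copies of the discrete group of integers) contains a Borel subgroup H such that H is meager in ℤ^ω but H cannot be covered by countably many closed Haar-meager subsets of ℤ^ω. Consequently there exist Borel sets (namely H itself) outside the σ-ideal generated by closed Haar-meager sets whose difference set H − H = H is meager. -/
open Pointwise

/-- A set `A` in a topological abelian group `X` is *Haar-meager* if there are a nonempty
compact metrizable space `K` and a continuous map `f : K → X` such that `f ⁻¹' (A + x)` is
meager in `K` for every `x ∈ X`. -/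
def HaarMeager {X : Type*} [TopologicalSpace X] [AddCommGroup X] (A : Set X) : Prop :=
  ∃ (K : Type) (tK : TopologicalSpace K),
    @CompactSpace K tK ∧ @TopologicalSpace.MetrizableSpace K tK ∧ Nonempty K ∧
    ∃ f : K → X, @Continuous K X tK _ f ∧
      ∀ x : X, @IsMeagre K tK (f ⁻¹' ((· + x) '' A))

open Filter Topology
open scoped Nat

/-- An injective code for the initial segment of length `n` of a sequence of naturals. -/
def history (p : ℕ → ℕ) : ℕ → ℕ
  | 0 => 0
  | n + 1 => Nat.pair (history p n) (p n) + 1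

/-- The code of the initial segment of `p` that ends with the last zero of `p` before `n`. -/
def lastMark (p : ℕ → ℕ) : ℕ → ℕ
  | 0 => 0
  | n + 1 => if p n = 0 then history p (n + 1) else lastMark p n

/-- The index of the block of integers containing the `n`-th coordinate of `blockMap p`. -/
def blockIndex (p : ℕ → ℕ) (n : ℕ) : ℕ := Nat.pair (lastMark p n) (p n).unpair.1

/-- The sequence whose `n`-th coordinate lies in the block that starts at the factorial of
`blockIndex p n` and has length `(p n).unpair.1`. -/
def blockMap (p : ℕ → ℕ) (n : ℕ) : ℤ :=
  (blockIndex p n)! + (min (p n).unpair.2 (p n).unpair.1 : ℕ)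

/-- The sequences of naturals with infinitely many zeros. -/
def frequentlyZero : Set (ℕ → ℕ) := {p | ∃ᶠ n in atTop, p n = 0}

theorem le_history (p : ℕ → ℕ) (n : ℕ) : n ≤ history p n := by
  induction n with
  | zero => exact Nat.zero_le _
  | succ n ih => exact Nat.succ_le_succ (ih.trans (Nat.left_le_pair _ _))

theorem history_eq_iff {p q : ℕ → ℕ} {m n : ℕ} :
    history p m = history q n ↔ m = n ∧ ∀ i < m, p i = q i := by
  induction m generalizing n with
  | zero => cases n <;> simp [history]
  | succ m ih =>
    cases n with
    | zero => simp [history]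
    | succ n =>
      simp only [history, Nat.add_right_cancel_iff, Nat.pair_eq_pair, ih, Nat.forall_lt_succ_right]
      constructor
      · rintro ⟨⟨rfl, h⟩, h'⟩
        exact ⟨rfl, h, h'⟩
      · rintro ⟨rfl, h, h'⟩
        exact ⟨⟨rfl, h⟩, h'⟩

theorem history_congr {p q : ℕ → ℕ} {n : ℕ} (h : ∀ i < n, p i = q i) :
    history p n = history q n :=
  history_eq_iff.2 ⟨rfl, h⟩

theorem lastMark_congr {p q : ℕ → ℕ} {n : ℕ} (h : ∀ i < n, p i = q i) :
    lastMark p n = lastMark q n := by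
  induction n with
  | zero => rfl
  | succ n ih =>
    simp only [lastMark, h n n.lt_succ_self, history_congr h,
      ih fun i hi => h i (hi.trans n.lt_succ_self)]

theorem blockMap_congr {p q : ℕ → ℕ} {n : ℕ} (h : ∀ i ≤ n, p i = q i) :
    blockMap p n = blockMap q n := by
  simp only [blockMap, blockIndex, h n le_rfl, lastMark_congr fun i hi => h i hi.le]

theorem exists_lastMark_eq_history {p : ℕ → ℕ} {i n : ℕ} (hp : p i = 0) (hn : i < n) :
    ∃ l > i, lastMark p n = history p l := by
  induction n with
  | zero => simp at hn
  | succ n ih =>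
    by_cases h : p n = 0
    · exact ⟨n + 1, hn, by simp [lastMark, h]⟩
    · have : i ≠ n := by rintro rfl; exact h hp
      obtain ⟨l, hl, e⟩ := ih (by omega)
      exact ⟨l, hl, by simp [lastMark, h, e]⟩

theorem lastMark_of_forall_ne_zero {p : ℕ → ℕ} {i n : ℕ} (hi : p i = 0)
    (h : ∀ j > i, p j ≠ 0) (hn : i < n) : lastMark p n = history p (i + 1) := by
  induction n, hn using Nat.le_induction with
  | base => simp [lastMark, hi]
  | succ n hn ih => simp [lastMark, h n hn, ih]

theorem eventually_le_lastMark {p : ℕ → ℕ} (hp : p ∈ frequentlyZero) (L : ℕ) :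
    ∀ᶠ n in atTop, L ≤ lastMark p n := by
  obtain ⟨i, hi, h⟩ := (frequently_atTop.1 hp) L
  filter_upwards [eventually_gt_atTop i] with n hn
  obtain ⟨l, hl, e⟩ := exists_lastMark_eq_history h hn
  have := le_history p l
  omega

theorem eventually_history_ne {p q : ℕ → ℕ} (hpq : p ≠ q) :
    ∀ᶠ n in atTop, history p n ≠ history q n := by
  obtain ⟨i, hi⟩ := Function.ne_iff.1 hpq
  filter_upwards [eventually_gt_atTop i] with n hn h
  exact hi ((history_eq_iff.1 h).2 i hn)

theorem eventually_lastMark_ne {p q : ℕ → ℕ} (hp : p ∈ frequentlyZero) (hpq : p ≠ q)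
    (hq : q ∈ frequentlyZero) : ∀ᶠ n in atTop, lastMark p n ≠ lastMark q n := by
  obtain ⟨i, hi⟩ := Function.ne_iff.1 hpq
  obtain ⟨a, ha, hpa⟩ := (frequently_atTop.1 hp) i
  obtain ⟨b, hb, hqb⟩ := (frequently_atTop.1 hq) i
  filter_upwards [eventually_gt_atTop a, eventually_gt_atTop b] with n hna hnb h
  obtain ⟨l, hl, e⟩ := exists_lastMark_eq_history hpa hna
  obtain ⟨l', hl', e'⟩ := exists_lastMark_eq_history hqb hnb
  rw [e, e', history_eq_iff] at h
  exact hi (h.2 i (by omega))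

theorem factorial_le_blockMap (p : ℕ → ℕ) (n : ℕ) : ((blockIndex p n)! : ℤ) ≤ blockMap p n := by
  simp [blockMap]

theorem blockMap_le (p : ℕ → ℕ) (n : ℕ) : blockMap p n ≤ 2 * (blockIndex p n)! := by
  have h : min (p n).unpair.2 (p n).unpair.1 ≤ (blockIndex p n)! :=
    (min_le_right _ _).trans ((Nat.right_le_pair _ _).trans (Nat.self_le_factorial _))
  simp only [blockMap]
  omega

theorem two_le_abs_sum_mul_of_factorial_le {α : Type*} {F : Finset α} (hF : F.Nonempty)
    {g v : α → ℤ} {j : α → ℕ} (hg : ∀ a ∈ F, g a ≠ 0) (hj : Set.InjOn j F)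
    (hE : ∀ a ∈ F, 2 * ∑ b ∈ F, |g b| + 2 ≤ j a)
    (hv : ∀ a ∈ F, ((j a)! : ℤ) ≤ v a) (hv' : ∀ a ∈ F, v a ≤ 2 * (j a)!) :
    2 ≤ |∑ a ∈ F, g a * v a| := by
  classical
  obtain ⟨a, ha, hmax⟩ := F.exists_max_image j hF
  set E := ∑ b ∈ F, |g b| with hEdef
  have hE0 : 0 ≤ E := Finset.sum_nonneg fun _ _ => abs_nonneg _
  obtain ⟨J, hJ⟩ : ∃ J, j a = J + 1 := Nat.exists_eq_succ_of_ne_zero (by have := hE a ha; omega)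
  have hfac : (1 : ℤ) ≤ J ! := by exact_mod_cast J.factorial_pos
  have hrest : |∑ b ∈ F.erase a, g b * v b| ≤ E * (2 * J !) := by
    calc |∑ b ∈ F.erase a, g b * v b| ≤ ∑ b ∈ F.erase a, |g b * v b| :=
          Finset.abs_sum_le_sum_abs _ _
      _ ≤ ∑ b ∈ F.erase a, |g b| * (2 * J !) := by
          refine Finset.sum_le_sum fun b hb => ?_
          have hbF := Finset.mem_of_mem_erase hb
          have hne : j b ≠ j a := fun h => Finset.ne_of_mem_erase hb (hj hbF ha h)
          have hle : j b ≤ J := by have := hmax b hbF; omega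
          have h1 : ((j b)! : ℤ) ≤ J ! := by exact_mod_cast Nat.factorial_le hle
          have h0 : (0 : ℤ) ≤ (j b)! := by positivity
          rw [abs_mul]
          refine mul_le_mul_of_nonneg_left ?_ (abs_nonneg _)
          rw [abs_of_nonneg (h0.trans (hv b hbF))]
          linarith [hv' b hbF]
      _ = (∑ b ∈ F.erase a, |g b|) * (2 * J !) := by rw [Finset.sum_mul]
      _ ≤ E * (2 * J !) := by
          refine mul_le_mul_of_nonneg_right ?_ (by positivity)
          exact Finset.sum_le_sum_of_subset_of_nonneg (Finset.erase_subset _ _)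
            fun _ _ _ => abs_nonneg _
  have htop : (2 * E + 2) * J ! ≤ |g a * v a| := by
    have h1 : 1 ≤ |g a| := Int.one_le_abs (hg a ha)
    have h2 : (2 * E + 2) * J ! ≤ v a := by
      refine le_trans ?_ (hv a ha)
      rw [hJ, Nat.factorial_succ]
      push_cast
      refine mul_le_mul_of_nonneg_right ?_ (by positivity)
      have := hE a ha
      rw [hJ] at this
      exact_mod_cast this
    rw [abs_mul]
    have h3 : v a ≤ |v a| := le_abs_self _
    nlinarith [abs_nonneg (v a)]
  rw [← Finset.add_sum_erase F _ ha]
  have := abs_sub_abs_le_abs_sub (g a * v a) (-∑ b ∈ F.erase a, g b * v b)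
  rw [abs_neg, sub_neg_eq_add] at this
  nlinarith

theorem eventually_two_le_abs_linearCombination_blockMap {l : (ℕ → ℕ) →₀ ℤ}
    (hl : (l.support : Set (ℕ → ℕ)) ⊆ frequentlyZero) (h0 : l ≠ 0) :
    ∀ᶠ n in atTop, 2 ≤ |Finsupp.linearCombination ℤ blockMap l n| := by
  have h1 : ∀ᶠ n in atTop, ∀ p ∈ l.support,
      (2 * ∑ b ∈ l.support, |l b| + 2).toNat ≤ lastMark p n :=
    (Finset.eventually_all _).2 fun p hp => eventually_le_lastMark (hl hp) _
  have h2 : ∀ᶠ n in atTop, ∀ p ∈ l.support, ∀ q ∈ l.support, p ≠ q →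
      lastMark p n ≠ lastMark q n :=
    (Finset.eventually_all _).2 fun p hp => (Finset.eventually_all _).2 fun q hq =>
      eventually_imp_distrib_left.2 fun hpq => eventually_lastMark_ne (hl hp) hpq (hl hq)
  filter_upwards [h1, h2] with n h1 h2
  have := two_le_abs_sum_mul_of_factorial_le (F := l.support) (g := l)
    (v := fun p => blockMap p n) (j := fun p => blockIndex p n)
    (Finsupp.support_nonempty_iff.2 h0) (fun p hp => Finsupp.mem_support_iff.1 hp)
    (fun p hp q hq h => by
      by_contra hpq
      exact h2 p hp q hq hpq (Nat.pair_eq_pair.1 h).1)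
    (fun p hp => by
      have := h1 p hp
      have h3 : lastMark p n ≤ blockIndex p n := Nat.left_le_pair _ _
      omega)
    (fun p _ => factorial_le_blockMap p n) (fun p _ => blockMap_le p n)
  simpa [Finsupp.linearCombination_apply, Finsupp.sum, Finset.sum_apply] using this

theorem linearIndepOn_blockMap : LinearIndepOn ℤ blockMap frequentlyZero := by
  rw [linearIndepOn_iff]
  intro l hl h
  by_contra h0
  obtain ⟨n, hn⟩ := (eventually_two_le_abs_linearCombination_blockMap hl h0).exists
  simp [h] at hn

theorem continuous_history (n : ℕ) : Continuous fun p => history p n := by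
  induction n with
  | zero => exact continuous_const
  | succ n ih =>
    exact (continuous_of_discreteTopology (f := fun a : ℕ × ℕ => Nat.pair a.1 a.2 + 1)).comp
      (ih.prodMk (continuous_apply n))

theorem continuous_lastMark (n : ℕ) : Continuous fun p => lastMark p n := by
  induction n with
  | zero => exact continuous_const
  | succ n ih =>
    exact (continuous_of_discreteTopology
      (f := fun a : ℕ × ℕ × ℕ => if a.1 = 0 then a.2.1 else a.2.2)).comp
      ((continuous_apply n).prodMk ((continuous_history (n + 1)).prodMk ih))

theorem continuous_blockMap : Continuous blockMap :=
  continuous_pi fun n =>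
    (continuous_of_discreteTopology
      (f := fun a : ℕ × ℕ =>
        (((Nat.pair a.1 a.2.unpair.1)! + (min a.2.unpair.2 a.2.unpair.1 : ℕ) : ℤ)))).comp
      ((continuous_lastMark n).prodMk (continuous_apply n))

/-- The subgroup generated by the sequences `blockMap p`, where `p` has infinitely many zeros. -/
def blockSubgroup : AddSubgroup (ℕ → ℤ) :=
  (Submodule.span ℤ (blockMap '' frequentlyZero)).toAddSubgroup

theorem mem_blockSubgroup {x : ℕ → ℤ} :
    x ∈ blockSubgroup ↔
      ∃ l ∈ Finsupp.supported ℤ ℤ frequentlyZero, Finsupp.linearCombination ℤ blockMap l = x :=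
  Finsupp.mem_span_image_iff_linearCombination ℤ

theorem measurableSet_frequentlyZero : MeasurableSet frequentlyZero := by
  have : frequentlyZero = ⋂ a : ℕ, ⋃ b ≥ a, {p : ℕ → ℕ | p b = 0} := by
    ext p
    simp [frequentlyZero, frequently_atTop]
  rw [this]
  exact .iInter fun a => .iUnion fun b => .iUnion fun _ =>
    measurable_pi_apply b (measurableSet_singleton 0)

/-- The tuples of sequences with infinitely many zeros whose initial segments of length `n` are
prescribed by the codes `s`. -/
def historyTuples {k : ℕ} (n : ℕ) (s : Fin k → ℕ) : Set (Fin k → ℕ → ℕ) :=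
  {c | ∀ i, c i ∈ frequentlyZero ∧ history (c i) n = s i}

theorem measurableSet_historyTuples {k : ℕ} (n : ℕ) (s : Fin k → ℕ) :
    MeasurableSet (historyTuples n s) := by
  have : historyTuples n s = ⋂ i, (fun c => c i) ⁻¹'
      (frequentlyZero ∩ (fun p => history p n) ⁻¹' {s i}) := by
    ext c
    simp [historyTuples]
  rw [this]
  exact .iInter fun i => measurable_pi_apply i <| measurableSet_frequentlyZero.inter <|
    (continuous_history n).measurable (measurableSet_singleton _)

theorem injOn_historyTuples {k n : ℕ} {s : Fin k → ℕ} (hs : Function.Injective s)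
    {e : Fin k → ℤ} (he : ∀ i, e i ≠ 0) :
    Set.InjOn (fun c : Fin k → ℕ → ℕ => ∑ i, e i • blockMap (c i)) (historyTuples n s) := by
  classical
  intro c hc c' hc' h
  have hinj : ∀ {d d' : Fin k → ℕ → ℕ}, d ∈ historyTuples n s → d' ∈ historyTuples n s →
      ∀ {i j}, d i = d' j → i = j := fun hd hd' i j hij =>
    hs (by rw [← (hd i).2, ← (hd' j).2, hij])
  set l : (ℕ → ℕ) →₀ ℤ :=
    ∑ i, Finsupp.single (c i) (e i) - ∑ i, Finsupp.single (c' i) (e i) with hl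
  have hl0 : l = 0 := by
    refine linearIndepOn_iff.1 linearIndepOn_blockMap l ?_ ?_
    · exact Submodule.sub_mem _
        (Submodule.sum_mem _ fun i _ => Finsupp.single_mem_supported ℤ _ (hc i).1)
        (Submodule.sum_mem _ fun i _ => Finsupp.single_mem_supported ℤ _ (hc' i).1)
    · simpa [hl, sub_eq_zero] using h
  funext i
  by_contra hne
  have h1 : l (c i) = e i := by
    have h2 : ∀ j, (Finsupp.single (c j) (e j)) (c i) = if j = i then e i else 0 := by
      intro j
      split_ifs with hji
      · simp [hji]
      · exact Finsupp.single_eq_of_ne fun hij => hji (hinj hc hc hij).symm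
    have h3 : ∀ j, (Finsupp.single (c' j) (e j)) (c i) = 0 := by
      intro j
      refine Finsupp.single_eq_of_ne fun hij => ?_
      obtain rfl := hinj hc hc' hij
      exact hne hij
    simp [hl, h2, h3]
  exact he i (by rw [← h1, hl0, Finsupp.zero_apply])

theorem coe_blockSubgroup_eq_iUnion :
    (blockSubgroup : Set (ℕ → ℤ)) =
      ⋃ (k : ℕ) (n : ℕ) (s : Fin k → ℕ) (e : Fin k → ℤ) (_ : Function.Injective s)
        (_ : ∀ i, e i ≠ 0), (fun c : Fin k → ℕ → ℕ => ∑ i, e i • blockMap (c i)) ''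
          historyTuples n s := by
  ext x
  simp only [Set.mem_iUnion, SetLike.mem_coe]
  constructor
  · intro hx
    obtain ⟨l, hl, rfl⟩ := mem_blockSubgroup.1 hx
    let en := l.support.equivFin.symm
    have h_en : ∀ᶠ n in atTop, ∀ i j, i ≠ j → history (en i) n ≠ history (en j) n :=
      eventually_all.2 fun i => eventually_all.2 fun j => eventually_imp_distrib_left.2 fun hij =>
        eventually_history_ne fun h => hij (en.injective (Subtype.ext h))
    obtain ⟨n, hn⟩ := h_en.exists
    refine ⟨_, n, fun i => history (en i) n, fun i => l (en i), ?_, ?_, fun i => en i, ?_, ?_⟩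
    · intro i j hij
      by_contra hne
      exact hn i j hne hij
    · exact fun i => Finsupp.mem_support_iff.1 (en i).2
    · exact fun i => ⟨hl (en i).2, rfl⟩
    · rw [Finsupp.linearCombination_apply, Finsupp.sum, ← Finset.sum_coe_sort l.support]
      exact en.sum_comp fun p : l.support => l p • blockMap p
  · rintro ⟨k, n, s, e, -, -, c, hc, rfl⟩
    exact Submodule.sum_mem _ fun i _ =>
      Submodule.smul_mem _ _ (Submodule.subset_span ⟨c i, (hc i).1, rfl⟩)

theorem measurableSet_blockSubgroup : MeasurableSet (blockSubgroup : Set (ℕ → ℤ)) := by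
  rw [coe_blockSubgroup_eq_iUnion]
  refine .iUnion fun k => .iUnion fun n => .iUnion fun s => .iUnion fun e =>
    .iUnion fun hs => .iUnion fun he => ?_
  refine (measurableSet_historyTuples n s).image_of_continuousOn_injOn
    (Continuous.continuousOn ?_) (injOn_historyTuples hs he)
  exact continuous_finsetSum _ fun i _ =>
    (continuous_blockMap.comp (continuous_apply i)).const_smul (e i)

theorem isMeagre_setOf_eventually_ne {E : Type*} [TopologicalSpace E] [DiscreteTopology E] (a : E) :
    IsMeagre {x : ℕ → E | ∀ᶠ n in atTop, x n ≠ a} := by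
  have h : {x : ℕ → E | ∀ᶠ n in atTop, x n ≠ a} = ⋃ m, {x | ∀ n ≥ m, x n ≠ a} := by
    ext x
    simp [eventually_atTop]
  rw [h]
  refine isMeagre_iUnion fun m => IsNowhereDense.isMeagre ?_
  have hcl : IsClosed {x : ℕ → E | ∀ n ≥ m, x n ≠ a} := by
    simp only [Set.ofPred_forall]
    exact isClosed_iInter fun n => isClosed_iInter fun _ =>
      (isClosed_discrete {a}ᶜ).preimage (continuous_apply (A := fun _ : ℕ => E) n)
  rw [hcl.isNowhereDense_iff, Set.eq_empty_iff_forall_notMem]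
  intro x hx
  have ht : Tendsto (fun n => Function.update x n a) atTop (𝓝 x) := by
    refine tendsto_pi_nhds.2 fun i => tendsto_const_nhds.congr' ?_
    filter_upwards [eventually_gt_atTop i] with n hn
    rw [Function.update_of_ne hn.ne]
  obtain ⟨n, hn, hnm⟩ :=
    ((ht.eventually (mem_interior_iff_mem_nhds.1 hx)).and (eventually_ge_atTop m)).exists
  exact hn n hnm (Function.update_self ..)

theorem isMeagre_blockSubgroup : IsMeagre (blockSubgroup : Set (ℕ → ℤ)) := by
  refine (isMeagre_setOf_eventually_ne (1 : ℤ)).mono fun x hx => ?_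
  obtain ⟨l, hl, rfl⟩ := mem_blockSubgroup.1 hx
  by_cases h0 : l = 0
  · simp [h0]
  · filter_upwards [eventually_two_le_abs_linearCombination_blockMap hl h0] with n hn h
    simp [h] at hn

theorem not_haarMeager_of_cylinder_subset {C : Set (ℕ → ℤ)} {p : ℕ → ℕ} {m : ℕ}
    (hC : PiNat.cylinder p m ⊆ blockMap ⁻¹' C) : ¬ HaarMeager C := by
  rintro ⟨K, tK, hK, hM, ⟨k₀⟩, f, hf, hmeagre⟩
  have hbdd : ∀ n, ∃ a : ℕ, ∀ k, |f k n| ≤ a := by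
    intro n
    obtain ⟨M, hM⟩ :=
      (isCompact_range ((continuous_abs.comp (continuous_apply n)).comp hf)).bddAbove
    exact ⟨M.toNat, fun k => (hM ⟨k, rfl⟩).trans (Int.self_le_toNat M)⟩
  choose a ha using hbdd
  let q₀ : ℕ → ℕ := fun n => if n < m then p n else 0
  let σ := history q₀ (m + 1)
  let q : K → ℕ → ℕ := fun k n =>
    if n ≤ m then q₀ n else Nat.pair (2 * a n + 1) (f k n + a n).toNat
  let y : ℕ → ℤ := fun n =>
    if n ≤ m then f k₀ n - blockMap q₀ n else -a n - (Nat.pair σ (2 * a n + 1))!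
  let U : Set K := {k | ∀ n ≤ m, f k n = f k₀ n}
  have hU : IsOpen U := by
    have : U = ⋂ n ∈ Set.Iic m, (fun k => f k n) ⁻¹' {f k₀ n} := by
      ext k
      simp [U]
    rw [this]
    exact (Set.finite_Iic m).isOpen_biInter fun n _ =>
      (isOpen_discrete _).preimage ((continuous_apply n).comp hf)
  refine not_isMeagre_of_isOpen hU ⟨k₀, fun _ _ => rfl⟩ ((hmeagre y).mono fun k hk => ?_)
  refine ⟨blockMap (q k), hC fun n hn => by simp [q, q₀, hn, hn.le], ?_⟩
  funext n
  have hagree : ∀ i ≤ m, q k i = q₀ i := fun i hi => by simp [q, hi]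
  rcases le_or_gt n m with hn | hn
  · simp [blockMap_congr fun i hi => hagree i (hi.trans hn), y, hn, hk n hn]
  · have hmark : lastMark (q k) n = σ := by
      rw [lastMark_of_forall_ne_zero (i := m) (by simp [q, q₀]) _ hn]
      · exact history_congr fun i hi => hagree i (Nat.lt_succ_iff.1 hi)
      · intro j hj
        have h1 := Nat.left_le_pair (2 * a j + 1) (f k j + a j).toNat
        simp only [q, hj.not_ge, if_false]
        omega
    have habs := abs_le.1 (ha n k)
    simp only [blockMap, blockIndex, hmark, Pi.add_apply, y, q, hn.not_ge, if_false,
      Nat.unpair_pair]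
    omega

theorem not_subset_iUnion_haarMeager {C : ℕ → Set (ℕ → ℤ)}
    (hC : ∀ n, IsClosed (C n) ∧ HaarMeager (C n)) :
    ¬ blockMap '' frequentlyZero ⊆ ⋃ n, C n := by
  intro hsub
  have hmeagre : ∀ n, IsMeagre (blockMap ⁻¹' C n) := by
    intro n
    refine IsNowhereDense.isMeagre ?_
    rw [((hC n).1.preimage continuous_blockMap).isNowhereDense_iff,
      Set.eq_empty_iff_forall_notMem]
    intro p hp
    obtain ⟨v, ⟨x, m, rfl⟩, hpv, hv⟩ := (PiNat.isTopologicalBasis_cylinders fun _ : ℕ => ℕ)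
      |>.exists_subset_of_mem_open hp isOpen_interior
    rw [← PiNat.mem_cylinder_iff_eq.1 hpv] at hv
    exact not_haarMeager_of_cylinder_subset (hv.trans interior_subset) (hC n).2
  refine not_isMeagre_of_isOpen (isOpen_univ (X := ℕ → ℕ)) Set.univ_nonempty ?_
  refine ((isMeagre_iUnion hmeagre).union (isMeagre_setOf_eventually_ne (0 : ℕ))).mono
    fun p _ => ?_
  by_cases hp : p ∈ frequentlyZero
  · left
    simpa using hsub ⟨p, hp, rfl⟩
  · right
    exact not_frequently.1 hp

/-- The Polish group `ℤ^ω` contains a Borel subgroup `H` which is meager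
in `ℤ^ω` but cannot be covered by countably many closed Haar-meager subsets of `ℤ^ω`;
moreover (being a subgroup) its difference set `H - H = H` is meager. -/
theorem stmt12 :
    ∃ H : AddSubgroup (ℕ → ℤ), MeasurableSet (H : Set (ℕ → ℤ)) ∧
      IsMeagre (H : Set (ℕ → ℤ)) ∧
      (¬ ∃ C : ℕ → Set (ℕ → ℤ), (∀ n, IsClosed (C n) ∧ HaarMeager (C n)) ∧
        (H : Set (ℕ → ℤ)) ⊆ ⋃ n, C n) ∧
      (H : Set (ℕ → ℤ)) - (H : Set (ℕ → ℤ)) = (H : Set (ℕ → ℤ)) := by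
  exact ⟨blockSubgroup, measurableSet_blockSubgroup, isMeagre_blockSubgroup,
    fun ⟨_, hC, hsub⟩ => not_subset_iUnion_haarMeager hC (Submodule.subset_span.trans hsub),
    coe_sub_coe blockSubgroup⟩
end
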